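/- arXiv:2005.02896 — 2 statements merged into one kernel-verified Lean document; each statement's English description precedes it below -/
import Mathlib

section
/- There exists a real number ε > 0 such that for every finite simple graph G that is hole-with-hat-free, G contains a clique or a stable (independent) set of cardinality at least |V(G)|^ε. -/
open Finset

namespace EHhat

variable {V : Type*}

/-- `c : ZMod n → V` describes a hole (induced cycle of length `n ≥ 4`) in `G`. -/
def IsHole (G : SimpleGraph V) (n : ℕ) (c : ZMod n → V) : Prop :=
  4 ≤ n ∧ Function.Injective c ∧
    ∀ i j : ZMod n, G.Adj (c i) (c j) ↔ (i - j = 1 ∨ j - i = 1)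

/-- `G` contains a hole together with a hat: a vertex outside the hole with exactly
two neighbours on the hole, and these two neighbours are adjacent (consecutive). -/
def HasHoleWithHat (G : SimpleGraph V) : Prop :=
  ∃ (n : ℕ) (c : ZMod n → V) (v : V) (i : ZMod n),
    IsHole G n c ∧ (∀ j, v ≠ c j) ∧ (∀ j, G.Adj v (c j) ↔ (j = i ∨ j = i + 1))

def HoleWithHatFree (G : SimpleGraph V) : Prop := ¬ HasHoleWithHat G

/-- A graph is perfect if chromatic number equals clique number for
every induced subgraph. -/
def IsPerfect [Fintype V] (G : SimpleGraph V) : Prop :=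
  ∀ S : Finset V,
    (G.induce (S : Set V)).chromaticNumber = ((G.induce (S : Set V)).cliqueNum : ℕ∞)

/-- `f` is a good function on `G`: it is nonnegative and sums to at most 1 on
every perfect induced subgraph of `G`. -/
def GoodOn [Fintype V] (G : SimpleGraph V) (f : V → ℝ) : Prop :=
  (∀ v, 0 ≤ f v) ∧
  ∀ S : Finset V, IsPerfect (G.induce (S : Set V)) → ∑ v ∈ S, f v ≤ 1

/-- `G` is `α`-narrow if `∑ v, f v ^ α ≤ 1` for every good function `f` on `G`. -/
def Narrow [Fintype V] (G : SimpleGraph V) (α : ℝ) : Prop :=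
  ∀ f : V → ℝ, GoodOn G f → ∑ v, f v ^ α ≤ 1

/-- `(G, f)` is an `α`-critical pair. -/
def Critical [Fintype V] (G : SimpleGraph V) (f : V → ℝ) (α : ℝ) : Prop :=
  GoodOn G f ∧
  (∀ S : Finset V, S ≠ Finset.univ → Narrow (G.induce (S : Set V)) α) ∧
  1 < ∑ v, f v ^ α

/-- `A` is complete to `B`. -/
def CompleteTo (G : SimpleGraph V) (A B : Set V) : Prop :=
  ∀ a ∈ A, ∀ b ∈ B, G.Adj a b

/-- `A` is anticomplete to `B`. -/
def AnticompleteTo (G : SimpleGraph V) (A B : Set V) : Prop :=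
  ∀ a ∈ A, ∀ b ∈ B, ¬ G.Adj a b

/-- The vertex `v` is complete to the set `C`. -/
def VertCompleteTo (G : SimpleGraph V) (v : V) (C : Set V) : Prop :=
  ∀ c ∈ C, G.Adj v c

/-- The vertex `v` is mixed on `C`: it has both a neighbour and a non-neighbour in `C`. -/
def MixedOn (G : SimpleGraph V) (v : V) (C : Set V) : Prop :=
  (∃ c ∈ C, G.Adj v c) ∧ (∃ c ∈ C, ¬ G.Adj v c)

/-- `X ⊆ V(G)` is connected: `G[X]` is a connected graph. -/
def ConnSet (G : SimpleGraph V) (X : Set V) : Prop :=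
  (G.induce X).Connected

/-- `X ⊆ V(G)` is anticonnected: the complement of `G[X]` is a connected graph. -/
def AnticonnSet (G : SimpleGraph V) (X : Set V) : Prop :=
  ((G.induce X)ᶜ).Connected

/-- The sum of `f` over a set `X` of vertices. -/
noncomputable def setSum [Fintype V] (f : V → ℝ) (X : Set V) : ℝ :=
  ∑ v, X.indicator f v

/-- `w` is a weight function making `(G, w)` a weighted graph. -/
def IsWeight [Fintype V] (w : V → ℝ) : Prop :=
  (∀ v, 0 ≤ w v) ∧ ∑ v, w v = 1

/-- The weighted graph `(G, w)` is `ε`-coherent. -/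
def Coherent [Fintype V] (G : SimpleGraph V) (w : V → ℝ) (ε : ℝ) : Prop :=
  (∀ v, w v < ε) ∧
  (∀ v, setSum w (G.neighborSet v) < ε) ∧
  ∀ A B : Set V, Disjoint A B → AnticompleteTo G A B →
    min (setSum w A) (setSum w B) < ε

/-- `Y` is (the vertex set of) a component of `G[X]`: a maximal connected subset of `X`. -/
def IsCompOf (G : SimpleGraph V) (X Y : Set V) : Prop :=
  Y ⊆ X ∧ ConnSet G Y ∧
  ∀ Z : Set V, Y ⊆ Z → Z ⊆ X → ConnSet G Z → Z = Y

/-- `Y` is the big component of `G[X]` (with respect to the weight `w` and `ε`). -/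
def IsBigComp [Fintype V] (G : SimpleGraph V) (w : V → ℝ) (ε : ℝ) (X Y : Set V) : Prop :=
  IsCompOf G X Y ∧ setSum w X - ε < setSum w Y

/-- `v` is an attachment of `A`: a vertex outside `A` with a neighbour in `A`. -/
def IsAttachment (G : SimpleGraph V) (A : Set V) (v : V) : Prop :=
  v ∉ A ∧ ∃ a ∈ A, G.Adj v a

/-- `(C, D)` is a split of the weighted graph `(G, w)`. -/
def IsSplit [Fintype V] (G : SimpleGraph V) (w : V → ℝ) (ε : ℝ) (C D : Set V) : Prop :=
  Disjoint C D ∧ 2 ≤ C.ncard ∧ ConnSet G C ∧ AnticonnSet G C ∧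
  D.Nonempty ∧ D = {v | v ∉ C ∧ ∀ c ∈ C, G.Adj v c} ∧
  ∀ Y : Set V, IsBigComp G w ε ((C ∪ D)ᶜ) Y → ∀ c ∈ C, ¬ IsAttachment G Y c

/-- A split is optimal if its first part is maximal among splits. -/
def IsOptimalSplit [Fintype V] (G : SimpleGraph V) (w : V → ℝ) (ε : ℝ) (C D : Set V) : Prop :=
  IsSplit G w ε C D ∧ ∀ C' D' : Set V, IsSplit G w ε C' D' → C ⊆ C' → C' = C

/-- `(A, C, D, B)` is a fracture of `(G, w)`: `(C, D)` is an optimal split, `A` is the union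
of the components of `G \ (C ∪ D)` with an attachment in `C`, and `B` is the rest. -/
def IsFracture [Fintype V] (G : SimpleGraph V) (w : V → ℝ) (ε : ℝ)
    (A C D B : Set V) : Prop :=
  IsOptimalSplit G w ε C D ∧
  A = {v | ∃ Y : Set V, IsCompOf G ((C ∪ D)ᶜ) Y ∧ v ∈ Y ∧ ∃ c ∈ C, IsAttachment G Y c} ∧
  B = ((C ∪ D)ᶜ : Set V) \ A

/-- The generating relation for the forcer graph: vertices `0,1,2,3` and `4,5,6,7`
each induce a path, and the two quadruples are complete to each other. -/
def forcerRel (i j : Fin 8) : Prop :=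
  (i.val < 4 ∧ 4 ≤ j.val) ∨ j.val = i.val + 1

/-- The forcer graph. -/
def forcer : SimpleGraph (Fin 8) := SimpleGraph.fromRel forcerRel

def ForcerFree (G : SimpleGraph V) : Prop := IsEmpty (forcer ↪g G)

/-- Given an embedded copy of the forcer via the vertex map `f`, one of its two
constituent paths has all its vertices in `S`. -/
def ConstituentPathIn (f : Fin 8 → V) (S : Set V) : Prop :=
  (∀ i : Fin 8, i.val < 4 → f i ∈ S) ∨ (∀ i : Fin 8, 4 ≤ i.val → f i ∈ S)

/-- `X` is a homogeneous set of `H`. -/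
def IsHomogeneousSet {W : Type*} (H : SimpleGraph W) (X : Set W) : Prop :=
  ∀ v ∉ X, (∀ x ∈ X, H.Adj v x) ∨ (∀ x ∈ X, ¬ H.Adj v x)

/-- `H` is guarded: for each forcer in `H` there is a proper homogeneous set
containing a constituent path of the forcer. -/
def Guarded {W : Type*} (H : SimpleGraph W) : Prop :=
  ∀ f : forcer ↪g H, ∃ X : Set W,
    X ≠ Set.univ ∧ IsHomogeneousSet H X ∧ ConstituentPathIn (fun i => f i) X

/-- The house: the complement of the five-vertex path. -/
def house : SimpleGraph (Fin 5) := (SimpleGraph.pathGraph 5)ᶜ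

def HouseFree (G : SimpleGraph V) : Prop := IsEmpty (house ↪g G)

/-- `g` is a good function on the induced subgraph `G[X]`. -/
def GoodOnSub [Fintype V] (G : SimpleGraph V) (X : Set V) (g : V → ℝ) : Prop :=
  (∀ v ∈ X, 0 ≤ g v) ∧
  ∀ S : Finset V, (S : Set V) ⊆ X → IsPerfect (G.induce (S : Set V)) →
    ∑ v ∈ S, g v ≤ 1

section Homogeneous

open scoped Classical

/-- The largest size of a clique of `G` inside `U`. -/
noncomputable def maxClique (G : SimpleGraph V) (U : Finset V) : ℕ :=
  (U.powerset.filter fun S : Finset V => G.IsClique (S : Set V)).sup card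

lemma exists_maxClique (G : SimpleGraph V) (U : Finset V) :
    ∃ S ⊆ U, G.IsClique (S : Set V) ∧ #S = maxClique G U := by
  have hne : (U.powerset.filter fun S : Finset V => G.IsClique (S : Set V)).Nonempty :=
    ⟨∅, by simp⟩
  obtain ⟨S, hS, h⟩ := exists_mem_eq_sup _ hne card
  simp only [mem_filter, mem_powerset] at hS
  exact ⟨S, hS.1, hS.2, h.symm⟩

lemma card_le_maxClique {G : SimpleGraph V} {U S : Finset V} (hSU : S ⊆ U)
    (hS : G.IsClique (S : Set V)) : #S ≤ maxClique G U :=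
  le_sup (f := card) (by simp [hSU, hS])

lemma maxClique_mono (G : SimpleGraph V) {U W : Finset V} (h : U ⊆ W) :
    maxClique G U ≤ maxClique G W := by
  obtain ⟨S, hS, hc, hcard⟩ := exists_maxClique G U
  exact hcard ▸ card_le_maxClique (hS.trans h) hc

/-- The product of the largest clique size and the largest stable set size inside `U`. -/
noncomputable def homMeasure (G : SimpleGraph V) (U : Finset V) : ℕ :=
  maxClique G U * maxClique Gᶜ U

lemma homMeasure_compl (G : SimpleGraph V) (U : Finset V) :
    homMeasure Gᶜ U = homMeasure G U := by
  simp [homMeasure, mul_comm]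

lemma homMeasure_mono (G : SimpleGraph V) {U W : Finset V} (h : U ⊆ W) :
    homMeasure G U ≤ homMeasure G W :=
  Nat.mul_le_mul (maxClique_mono _ h) (maxClique_mono _ h)

lemma homMeasure_union {G : SimpleGraph V} {A B : Finset V} (hd : Disjoint A B)
    (h : AnticompleteTo G (A : Set V) B) :
    homMeasure G A + homMeasure G B ≤ homMeasure G (A ∪ B) := by
  have hcompl : maxClique Gᶜ A + maxClique Gᶜ B ≤ maxClique Gᶜ (A ∪ B) := by
    obtain ⟨S, hS, hSc, hSn⟩ := exists_maxClique Gᶜ A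
    obtain ⟨T, hT, hTc, hTn⟩ := exists_maxClique Gᶜ B
    rw [← hSn, ← hTn, ← card_union_of_disjoint (hd.mono hS hT)]
    refine card_le_maxClique (union_subset_union hS hT) ?_
    intro x hx y hy hxy
    simp only [coe_union, Set.mem_union, mem_coe] at hx hy
    rcases hx with hx | hx <;> rcases hy with hy | hy
    · exact hSc hx hy hxy
    · exact (SimpleGraph.compl_adj _ _ _).2 ⟨hxy, h x (hS hx) y (hT hy)⟩
    · exact (SimpleGraph.compl_adj _ _ _).2 ⟨hxy, fun e => h y (hS hy) x (hT hx) e.symm⟩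
    · exact hTc hx hy hxy
  calc homMeasure G A + homMeasure G B
      ≤ maxClique G (A ∪ B) * maxClique Gᶜ A + maxClique G (A ∪ B) * maxClique Gᶜ B :=
        Nat.add_le_add (Nat.mul_le_mul_right _ (maxClique_mono _ subset_union_left))
          (Nat.mul_le_mul_right _ (maxClique_mono _ subset_union_right))
    _ = maxClique G (A ∪ B) * (maxClique Gᶜ A + maxClique Gᶜ B) := by ring
    _ ≤ _ := Nat.mul_le_mul_left _ hcompl

lemma sum_homMeasure_le {G : SimpleGraph V} {ι : Type*} {D : ι → Finset V} (I : Finset ι)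
    (hd : ∀ i ∈ I, ∀ j ∈ I, i ≠ j → Disjoint (D i) (D j))
    (h : ∀ i ∈ I, ∀ j ∈ I, i ≠ j → AnticompleteTo G (D i : Set V) (D j)) :
    ∑ i ∈ I, homMeasure G (D i) ≤ homMeasure G (I.biUnion D) := by
  induction I using Finset.induction_on with
  | empty => simp
  | insert i I hi ih =>
    rw [sum_insert hi, biUnion_insert]
    have ih' := ih (fun a ha b hb => hd a (mem_insert_of_mem ha) b (mem_insert_of_mem hb))
      (fun a ha b hb => h a (mem_insert_of_mem ha) b (mem_insert_of_mem hb))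
    refine (Nat.add_le_add_left ih' _).trans (homMeasure_union ?_ ?_)
    · rw [disjoint_biUnion_right]
      intro j hj
      exact hd i (mem_insert_self _ _) j (mem_insert_of_mem hj) (by rintro rfl; exact hi hj)
    · intro a ha b hb
      obtain ⟨j, hj, hbj⟩ := mem_biUnion.1 (mem_coe.1 hb)
      exact h i (mem_insert_self _ _) j (mem_insert_of_mem hj) (by rintro rfl; exact hi hj)
        a ha b hbj

lemma one_le_maxClique (G : SimpleGraph V) {U : Finset V} (hU : U.Nonempty) :
    1 ≤ maxClique G U := by
  obtain ⟨x, hx⟩ := hU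
  exact card_le_maxClique (S := {x}) (by simpa using hx) (by simp)

lemma two_le_homMeasure (G : SimpleGraph V) {U : Finset V} (hU : 2 ≤ #U) :
    2 ≤ homMeasure G U := by
  obtain ⟨x, hx, y, hy, hxy⟩ := one_lt_card.1 hU
  have hne : U.Nonempty := ⟨x, hx⟩
  have hsub : ({x, y} : Finset V) ⊆ U := by
    simp [insert_subset_iff, hx, hy]
  have key : ∀ H : SimpleGraph V, H.Adj x y → 2 ≤ maxClique H U := by
    intro H hH
    rw [← card_pair hxy]
    refine card_le_maxClique hsub ?_
    simp [SimpleGraph.isClique_iff, hH]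
  by_cases h : G.Adj x y
  · exact Nat.mul_le_mul (key G h) (one_le_maxClique Gᶜ hne)
  · exact Nat.mul_le_mul (one_le_maxClique G hne) (key Gᶜ (by simp [hxy, h]))

/-- Connectedness of a finite vertex set, phrased by cuts. -/
def Linked (G : SimpleGraph V) (D : Finset V) : Prop :=
  D.Nonempty ∧ ∀ A ⊆ D, A.Nonempty → A ≠ D → ∃ a ∈ A, ∃ b ∈ D \ A, G.Adj a b

lemma linked_singleton (G : SimpleGraph V) (x : V) : Linked G {x} := by
  refine ⟨by simp, fun A hA hne hA' => ?_⟩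
  rcases subset_singleton_iff.1 hA with h | h
  · simp [h] at hne
  · exact absurd h hA'

lemma exists_component (G : SimpleGraph V) {X : Finset V} {x : V} (hx : x ∈ X) :
    ∃ D ⊆ X, x ∈ D ∧ Linked G D ∧ AnticompleteTo G (D : Set V) (X \ D : Finset V) := by
  let F := X.powerset.filter fun D : Finset V =>
    x ∈ D ∧ AnticompleteTo G (D : Set V) (X \ D : Finset V)
  have hF : F.Nonempty := ⟨X, by
    simpa [F, hx, AnticompleteTo] using fun _ _ _ hb hb' => absurd hb hb'⟩
  obtain ⟨D, hD, hmin⟩ := exists_min_image F card hF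
  simp only [F, mem_filter, mem_powerset] at hD hmin
  obtain ⟨hDX, hxD, hDc⟩ := hD
  have small : ∀ A ⊆ D, A ≠ D → x ∈ A → ∃ a ∈ A, ∃ b ∈ D \ A, G.Adj a b := by
    intro A hA hAD hxA
    by_contra! hno
    have := hmin A ⟨hA.trans hDX, hxA, fun a ha b hb => by
      by_cases hbD : b ∈ D
      · exact hno a ha b (mem_sdiff.2 ⟨hbD, (mem_sdiff.1 (mem_coe.1 hb)).2⟩)
      · exact hDc a (hA ha) b (by simpa [hbD] using (mem_sdiff.1 (mem_coe.1 hb)).1)⟩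
    exact absurd (card_lt_card (hA.ssubset_of_ne hAD)) (not_lt.2 this)
  refine ⟨D, hDX, hxD, ⟨⟨x, hxD⟩, fun A hA hne hAD => ?_⟩, hDc⟩
  by_cases hxA : x ∈ A
  · exact small A hA hAD hxA
  · obtain ⟨a, ha, b, hb, hab⟩ := small (D \ A) sdiff_subset (by
      intro h
      obtain ⟨y, hy⟩ := hne
      have := hA hy
      rw [← h] at this
      exact (mem_sdiff.1 this).2 hy) (by simp [hxD, hxA])
    rw [_root_.sdiff_sdiff_eq_self hA] at hb
    exact ⟨b, hb, a, ha, hab.symm⟩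

lemma Linked.insert {G : SimpleGraph V} {D : Finset V} (h : Linked G D) {d k : V} (hk : k ∈ D)
    (hkd : G.Adj k d) : Linked G (insert d D) := by
  refine ⟨by simp, fun A hA hne hAD => ?_⟩
  by_cases hdD : d ∈ D
  · rw [insert_eq_of_mem hdD] at *
    exact h.2 A hA hne hAD
  by_cases hdA : d ∈ A
  · by_cases hkA : k ∈ A
    · obtain ⟨a, ha, b, hb, hab⟩ := h.2 (A.erase d) (by
        intro y hy
        rw [mem_erase] at hy
        exact (mem_insert.1 (hA hy.2)).resolve_left hy.1)
        ⟨k, by simp [hkA, hkd.ne]⟩ (by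
          rintro rfl
          exact hAD (insert_erase hdA).symm)
      refine ⟨a, (mem_erase.1 ha).2, b, ?_, hab⟩
      simp only [mem_sdiff, mem_erase, mem_insert] at hb ⊢
      have : b ≠ d := fun e => hdD (e ▸ hb.1)
      tauto
    · exact ⟨d, hdA, k, by simp [hk, hkA], hkd.symm⟩
  · have hAD' : A ⊆ D := fun y hy =>
      (mem_insert.1 (hA hy)).resolve_left (by rintro rfl; exact hdA hy)
    by_cases hAe : A = D
    · subst hAe
      exact ⟨k, hk, d, by simp [hdA], hkd⟩
    · obtain ⟨a, ha, b, hb, hab⟩ := h.2 A hAD' hne hAe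
      rw [mem_sdiff] at hb
      exact ⟨a, ha, b, by simp [hb.1, hb.2], hab⟩

/-- No two disjoint anticomplete subsets of `S` both have size at least `m`. -/
def NoAnticompletePair (G : SimpleGraph V) (S : Finset V) (m : ℝ) : Prop :=
  ∀ A ⊆ S, ∀ B ⊆ S, Disjoint A B → AnticompleteTo G (A : Set V) B → m ≤ #A → (#B : ℝ) < m

lemma NoAnticompletePair.exists_large_component {G : SimpleGraph V} {S W : Finset V} {m : ℝ}
    (h : NoAnticompletePair G S m) (hm : 0 < m) (hWS : W ⊆ S) (hW : 2 * m ≤ #W) :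
    ∃ D ⊆ W, Linked G D ∧ AnticompleteTo G (D : Set V) (W \ D : Finset V) ∧
      #W - 2 * m ≤ (#D : ℝ) := by
  let 𝓕 := W.powerset.filter fun F : Finset V =>
    AnticompleteTo G (F : Set V) (W \ F : Finset V) ∧ 2 * #F ≤ #W
  have h𝓕 : 𝓕.Nonempty := ⟨∅, by simp [𝓕, AnticompleteTo]⟩
  obtain ⟨F, hF, hmax⟩ := exists_max_image 𝓕 card h𝓕
  simp only [𝓕, mem_filter, mem_powerset] at hF hmax
  obtain ⟨hFW, hFc, hFn⟩ := hF
  have hcard := card_sdiff_add_card_eq_card hFW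
  have hcardR : (#(W \ F) : ℝ) + #F = #W := by exact_mod_cast hcard
  have hFnR : 2 * (#F : ℝ) ≤ #W := by exact_mod_cast hFn
  have hFm : (#F : ℝ) < m := by
    refine h (W \ F) (sdiff_subset.trans hWS) F (hFW.trans hWS) sdiff_disjoint ?_ (by linarith)
    exact fun a ha b hb e => hFc b hb a ha e.symm
  obtain ⟨x, hx⟩ : (W \ F).Nonempty := by
    rw [← card_pos]
    have : (0 : ℝ) < #(W \ F) := by linarith
    exact_mod_cast this
  obtain ⟨D, hD, hxD, hDl, hDc⟩ := exists_component G hx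
  have hdis : Disjoint D F := disjoint_of_subset_left hD sdiff_disjoint
  have hDW : D ⊆ W := hD.trans sdiff_subset
  have hFDc : AnticompleteTo G ((F ∪ D : Finset V) : Set V) (W \ (F ∪ D) : Finset V) := by
    intro a ha b hb
    simp only [coe_union, Set.mem_union, mem_coe, coe_sdiff, Set.mem_sdiff, not_or] at ha hb
    rcases ha with ha | ha
    · exact hFc a ha b (by simp [hb])
    · exact hDc a ha b (by simp [hb])
  have hbig : #W < 2 * #(F ∪ D) := by
    by_contra! hle
    have := hmax (F ∪ D) ⟨union_subset hFW hDW, hFDc, hle⟩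
    rw [card_union_of_disjoint hdis.symm] at this
    have : 0 < #D := card_pos.2 ⟨x, hxD⟩
    omega
  have hrest : (#(W \ (F ∪ D)) : ℝ) < m := by
    refine h (F ∪ D) ((union_subset hFW hDW).trans hWS) _ (sdiff_subset.trans hWS)
      disjoint_sdiff hFDc ?_
    have : (#W : ℝ) < 2 * #(F ∪ D) := by exact_mod_cast hbig
    linarith
  have hc2 : (#(W \ (F ∪ D)) : ℝ) + (#F + #D) = #W := by
    rw [← Nat.cast_add, ← card_union_of_disjoint hdis.symm]
    exact_mod_cast card_sdiff_add_card_eq_card (union_subset hFW hDW)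
  refine ⟨D, hDW, hDl, ?_, by linarith⟩
  intro a ha b hb
  rw [mem_coe, mem_sdiff] at hb
  by_cases hbF : b ∈ F
  · exact fun e => hFc b hbF a (by simpa using hD ha) e.symm
  · exact hDc a ha b (by simp [hb, hbF])

end Homogeneous

section Holes

open scoped Classical

lemma zmod_sub_eq_one_iff {n : ℕ} [NeZero n] (hn : 2 ≤ n) (i j : ZMod n) :
    i - j = 1 ↔ i.val = j.val + 1 ∨ (i.val = 0 ∧ j.val + 1 = n) := by
  have : Fact (1 < n) := ⟨hn⟩
  have hi := ZMod.val_lt i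
  have hj := ZMod.val_lt j
  rw [sub_eq_iff_eq_add', ← (ZMod.val_injective n).eq_iff, ZMod.val_add, ZMod.val_one]
  rcases Nat.lt_or_ge (j.val + 1) n with h | h
  · rw [Nat.mod_eq_of_lt h]; omega
  · have : j.val + 1 = n := by omega
    rw [this, Nat.mod_self]; omega

/-- A hole with hat given by a sequence indexed by natural numbers below `n`. -/
lemma hasHoleWithHat_of_seq {G : SimpleGraph V} {n : ℕ} (hn : 4 ≤ n) (q : ℕ → V) (v : V) (k : ℕ)
    (hk : k < n)
    (hinj : ∀ i j, i < j → j < n → q i ≠ q j)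
    (hadj : ∀ i j, i < j → j < n → (G.Adj (q i) (q j) ↔ j = i + 1 ∨ (i = 0 ∧ j + 1 = n)))
    (hv : ∀ j < n, v ≠ q j)
    (hhat : ∀ j < n, G.Adj v (q j) ↔ (j = k ∨ j = k + 1 ∨ (j = 0 ∧ k + 1 = n))) :
    HasHoleWithHat G := by
  have : NeZero n := ⟨by omega⟩
  have hval : ((k : ZMod n)).val = k := ZMod.val_natCast_of_lt hk
  refine ⟨n, fun i => q i.val, v, (k : ZMod n), ⟨hn, ?_, ?_⟩, fun j => hv _ (ZMod.val_lt j), ?_⟩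
  · intro i j hij
    apply ZMod.val_injective n
    rcases lt_trichotomy i.val j.val with h | h | h
    · exact absurd hij (hinj _ _ h (ZMod.val_lt j))
    · exact h
    · exact absurd hij.symm (hinj _ _ h (ZMod.val_lt i))
  · intro i j
    have hi := ZMod.val_lt i
    have hj := ZMod.val_lt j
    rw [zmod_sub_eq_one_iff (by omega), zmod_sub_eq_one_iff (by omega)]
    rcases lt_trichotomy i.val j.val with h | h | h
    · rw [hadj _ _ h hj]; omega
    · simp only [h, SimpleGraph.irrefl, false_iff]; omega
    · rw [G.adj_comm, hadj _ _ h hi]; omega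
  · intro j
    have hj := ZMod.val_lt j
    rw [hhat _ hj, ← sub_eq_iff_eq_add', zmod_sub_eq_one_iff (by omega), hval,
      ← (ZMod.val_injective n).eq_iff, hval]

/-- Two vertices with neighbours in a linked set are joined by an induced path through it. -/
lemma Linked.exists_induced_path {G : SimpleGraph V} {K : Finset V} (hK : Linked G K) {a b : V}
    (hab : a ≠ b) (ha : ∃ k ∈ K, G.Adj a k) (hb : ∃ k ∈ K, G.Adj b k) :
    ∃ (l : ℕ) (p : ℕ → V), 1 ≤ l ∧ p 0 = a ∧ p l = b ∧ (∀ i, 0 < i → i < l → p i ∈ K) ∧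
      (∀ i j, i < j → j ≤ l → p i ≠ p j) ∧
      (∀ i j, i < j → j ≤ l → (G.Adj (p i) (p j) ↔ j = i + 1)) := by
  let X : Set V := {v | v ∈ K ∨ v = a ∨ v = b}
  let H := G.induce X
  let a' : X := ⟨a, by simp [X]⟩
  let b' : X := ⟨b, by simp [X]⟩
  have hreach : H.Reachable a' b' := by
    let A := K.filter fun k => ∃ h : k ∈ X, H.Reachable a' ⟨k, h⟩
    have hAK : A = K := by
      by_contra hne
      obtain ⟨k, hk, hak⟩ := ha
      have hAne : A.Nonempty := ⟨k, mem_filter.2 ⟨hk, Or.inl hk,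
        SimpleGraph.Adj.reachable (by simpa [H, a'] using hak)⟩⟩
      obtain ⟨x, hx, y, hy, hxy⟩ := hK.2 A (filter_subset _ _) hAne hne
      obtain ⟨hyK, hyA⟩ := mem_sdiff.1 hy
      obtain ⟨hxK, hxX, hxr⟩ := mem_filter.1 hx
      refine hyA (mem_filter.2 ⟨hyK, Or.inl hyK, hxr.trans ?_⟩)
      exact SimpleGraph.Adj.reachable (by simpa [H] using hxy)
    obtain ⟨k, hk, hbk⟩ := hb
    rw [← hAK] at hk
    obtain ⟨hkK, hkX, hkr⟩ := mem_filter.1 hk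
    exact hkr.trans (SimpleGraph.Adj.reachable (by simpa [H, b'] using hbk.symm))
  obtain ⟨w, hw⟩ := hreach.exists_walk_length_eq_dist
  have hinj : ∀ i j, i < j → j ≤ w.length → w.getVert i ≠ w.getVert j := by
    intro i j hij hj h
    have := H.dist_le ((w.take i).append ((w.drop j).copy h.symm rfl))
    rw [SimpleGraph.Walk.length_append, SimpleGraph.Walk.length_copy,
      SimpleGraph.Walk.take_length, SimpleGraph.Walk.drop_length] at this
    omega
  have hadj : ∀ i j, i < j → j ≤ w.length →
      (H.Adj (w.getVert i) (w.getVert j) ↔ j = i + 1) := by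
    intro i j hij hj
    constructor
    · intro h
      have := H.dist_le ((w.take i).append (.cons h (w.drop j)))
      rw [SimpleGraph.Walk.length_append, SimpleGraph.Walk.length_cons,
        SimpleGraph.Walk.take_length, SimpleGraph.Walk.drop_length] at this
      omega
    · rintro rfl
      exact w.adj_getVert_succ (by omega)
  have hne : a' ≠ b' := fun h => hab (congrArg Subtype.val h)
  have hlen : 1 ≤ w.length := by
    rw [hw]; exact hreach.pos_dist_of_ne hne
  refine ⟨w.length, fun i => (w.getVert i : V), hlen, by simp [a'], by simp [b'], ?_, ?_, ?_⟩
  · intro i hi hil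
    have h0 := hinj 0 i hi hil.le
    have h1 := hinj i w.length hil le_rfl
    rcases (w.getVert i).2 with h | h | h
    · exact h
    · exact absurd (Subtype.ext (by simpa using h.symm)) h0
    · exact absurd (Subtype.ext (by simpa using h)) h1
  · intro i j hij hj h
    exact hinj i j hij hj (Subtype.ext h)
  · intro i j hij hj
    rw [← hadj i j hij hj]
    simp [H]

/-- An induced path `a x y b` whose ends attach to a linked set `K`, where `x`, `y` and a vertex
`w` are anticomplete to `K`: if `w` sees exactly two consecutive vertices of the path, one of
them being `x`, then there is a hole with hat. -/
lemma Linked.hasHoleWithHat {G : SimpleGraph V} {K : Finset V} (hK : Linked G K) {a x y b w : V}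
    (ha : ∃ k ∈ K, G.Adj a k) (hb : ∃ k ∈ K, G.Adj b k)
    (hab : a ≠ b) (hxK : ∀ k ∈ K, x ≠ k ∧ ¬ G.Adj x k) (hyK : ∀ k ∈ K, y ≠ k ∧ ¬ G.Adj y k)
    (hwK : ∀ k ∈ K, w ≠ k ∧ ¬ G.Adj w k)
    (hax : G.Adj a x) (hxy : G.Adj x y) (hyb : G.Adj y b) (hay : ¬ G.Adj a y) (hxb : ¬ G.Adj x b)
    (hay' : a ≠ y) (hxb' : x ≠ b) (hw : w ≠ a ∧ w ≠ x ∧ w ≠ y ∧ w ≠ b) (hwx : G.Adj w x)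
    (hwb : ¬ G.Adj w b) (hway : G.Adj w a ↔ ¬ G.Adj w y) : HasHoleWithHat G := by
  obtain ⟨l, p, hl, hp0, hpl, hpK, hpinj, hpadj⟩ :=
    hK.exists_induced_path hab ha hb
  let q : ℕ → V := fun i => if i ≤ l then p i else if i = l + 1 then y else x
  have hq : ∀ i ≤ l, q i = p i := fun i hi => by simp [q, hi]
  have hq1 : q (l + 1) = y := by simp [q]
  have hq2 : q (l + 2) = x := by simp [q]
  have cases_le : ∀ i ≤ l, i = 0 ∨ i = l ∨ (0 < i ∧ i < l) := fun i hi => by omega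
  have hne : ∀ z, (∀ k ∈ K, z ≠ k ∧ ¬ G.Adj z k) → z ≠ a → z ≠ b → ∀ i ≤ l, z ≠ p i := by
    intro z hzK hza hzb i hi
    rcases cases_le i hi with rfl | rfl | h
    · rwa [hp0]
    · rwa [hpl]
    · exact (hzK _ (hpK i h.1 h.2)).1
  have hnadj : ∀ z, (∀ k ∈ K, z ≠ k ∧ ¬ G.Adj z k) → ∀ i ≤ l,
      (G.Adj z (p i) ↔ (i = 0 ∧ G.Adj z a) ∨ (i = l ∧ G.Adj z b)) := by
    intro z hzK i hi
    rcases cases_le i hi with rfl | rfl | h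
    · rw [hp0]
      have : 0 ≠ l := by omega
      simp [this]
    · rw [hpl]
      have : i ≠ 0 := by omega
      simp [this]
    · have h0 : i ≠ 0 := by omega
      have h1 : i ≠ l := by omega
      simp [h0, h1, (hzK _ (hpK i h.1 h.2)).2]
  refine hasHoleWithHat_of_seq (n := l + 3) (by omega) q w
    (if G.Adj w y then l + 1 else l + 2) (by split_ifs <;> omega) ?_ ?_ ?_ ?_
  · intro i j hij hj
    rcases (by omega : j ≤ l ∨ j = l + 1 ∨ j = l + 2) with h | rfl | rfl
    · rw [hq i (by omega), hq j h]; exact hpinj i j hij h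
    · rw [hq i (by omega), hq1]
      exact (hne y hyK hay'.symm hyb.ne i (by omega)).symm
    · rw [hq2]
      rcases (by omega : i ≤ l ∨ i = l + 1) with h | rfl
      · rw [hq i h]
        exact (hne x hxK hax.ne' hxb' i h).symm
      · rw [hq1]; exact hxy.ne'
  · intro i j hij hj
    rcases (by omega : j ≤ l ∨ j = l + 1 ∨ j = l + 2) with h | rfl | rfl
    · rw [hq i (by omega), hq j h, hpadj i j hij h]; omega
    · rw [hq i (by omega), hq1, G.adj_comm, hnadj y hyK i (by omega)]
      simp only [hyb, G.adj_comm y a, hay]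
      simp; omega
    · rw [hq2]
      rcases (by omega : i ≤ l ∨ i = l + 1) with h | rfl
      · rw [hq i h, G.adj_comm, hnadj x hxK i h]
        simp only [G.adj_comm x a, hax, hxb]
        simp; omega
      · rw [hq1]; simp [hxy.symm]
  · intro j hj
    rcases (by omega : j ≤ l ∨ j = l + 1 ∨ j = l + 2) with h | rfl | rfl
    · rw [hq j h]; exact hne w hwK hw.1 hw.2.2.2 j h
    · rw [hq1]; exact hw.2.2.1
    · rw [hq2]; exact hw.2.1
  · intro j hj
    rcases (by omega : j ≤ l ∨ j = l + 1 ∨ j = l + 2) with h | rfl | rfl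
    · rw [hq j h, hnadj w hwK j h]
      by_cases hwy : G.Adj w y
      · simp [hwy, hwb, hway]; omega
      · simp [hwy, hwb, hway]; omega
    · rw [hq1]
      by_cases hwy : G.Adj w y <;> simp [hwy]
    · rw [hq2]
      by_cases hwy : G.Adj w y <;> simp [hwy, hwx]

end Holes

section Comb

open scoped Classical

/-- Some set of vertices of `A` has many private neighbours in `B`, relative to its size. -/
lemma exists_comb {G : SimpleGraph V} {A B : Finset V} {n : ℝ} (hn : 100 ≤ n)
    (hdeg : ∀ a ∈ A, (#(B.filter (G.Adj a)) : ℝ) ≤ n / 100)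
    (hcov : ∀ b ∈ B, ∃ a ∈ A, G.Adj a b) (hB : 2 / 5 * n ≤ #B) :
    ∃ T ⊆ A, 8 ≤ #T ∧ ∀ a ∈ T, n / 100 ≤
      #(B.filter fun b => G.Adj a b ∧ ∀ a' ∈ T, a' ≠ a → ¬ G.Adj a' b) * (#T : ℝ) ^ 2 := by
  let N : Finset V → Finset V := fun T => B.filter fun b => ∃ a ∈ T, G.Adj a b
  let f : ℝ → Finset V → ℝ := fun l T => #(N T) - l * #T
  have hmax : ∀ l, ∃ T ⊆ A, ∀ T' ⊆ A, f l T' ≤ f l T := by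
    intro l
    obtain ⟨T, hT, h⟩ := exists_max_image A.powerset (f l) ⟨∅, by simp⟩
    exact ⟨T, mem_powerset.1 hT, fun T' hT' => h T' (mem_powerset.2 hT')⟩
  choose T hTA hTmax using hmax
  let l : ℕ → ℝ := fun s => n / 100 / 4 ^ s
  have hprivate : ∀ s, ∀ a ∈ T (l s), l s ≤
      #(B.filter fun b => G.Adj a b ∧ ∀ a' ∈ T (l s), a' ≠ a → ¬ G.Adj a' b) := by
    intro s a ha
    have h := hTmax (l s) ((T (l s)).erase a) ((erase_subset _ _).trans (hTA _))
    have hc : (#((T (l s)).erase a) : ℝ) = #(T (l s)) - 1 := by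
      rw [card_erase_of_mem ha, Nat.cast_sub (card_pos.2 ⟨a, ha⟩), Nat.cast_one]
    have hN : N (T (l s)) ⊆ N ((T (l s)).erase a) ∪
        B.filter fun b => G.Adj a b ∧ ∀ a' ∈ T (l s), a' ≠ a → ¬ G.Adj a' b := by
      intro b hb
      simp only [N, mem_filter, mem_union, mem_erase] at hb ⊢
      obtain ⟨hbB, c, hc, hcb⟩ := hb
      by_cases hex : ∃ a' ∈ T (l s), a' ≠ a ∧ G.Adj a' b
      · obtain ⟨a', h1, h2, h3⟩ := hex
        exact Or.inl ⟨hbB, a', ⟨h2, h1⟩, h3⟩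
      · push Not at hex
        have hca : c = a := by
          by_contra hca
          exact hex c hc hca hcb
        exact Or.inr ⟨hbB, hca ▸ hcb, hex⟩
    have hNc : (#(N (T (l s))) : ℝ) ≤ #(N ((T (l s)).erase a)) +
        #(B.filter fun b => G.Adj a b ∧ ∀ a' ∈ T (l s), a' ≠ a → ¬ G.Adj a' b) := by
      exact_mod_cast (card_le_card hN).trans (card_union_le _ _)
    simp only [f, hc] at h
    linarith
  by_cases hbig : ∃ s, 8 * 2 ^ s ≤ #(T (l s))
  · obtain ⟨s, hs⟩ := hbig
    have hsR : (8 * 2 ^ s : ℝ) ≤ #(T (l s)) := by exact_mod_cast hs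
    have h1 : (1 : ℝ) ≤ 2 ^ s := one_le_pow₀ (by norm_num)
    refine ⟨T (l s), hTA _, ?_, fun a ha => ?_⟩
    · exact_mod_cast (by linarith : (8 : ℝ) ≤ #(T (l s)))
    · have hsq : (4 : ℝ) ^ s ≤ (#(T (l s)) : ℝ) ^ 2 := by
        calc (4 : ℝ) ^ s = (2 ^ s) ^ 2 := by rw [← pow_mul, mul_comm s 2, pow_mul]; norm_num
          _ ≤ _ := by gcongr; linarith
      calc n / 100 = l s * 4 ^ s := by simp only [l]; field_simp
        _ ≤ _ := by
          have : 0 ≤ l s := by simp only [l]; positivity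
          gcongr
          exact hprivate s a ha
  · exfalso
    push Not at hbig
    have hsum : ∀ s, f (l s) (T (l s)) ≤ 24 / 100 * n * (1 - 1 / 2 ^ s) := by
      intro s
      induction s with
      | zero =>
        have hN : (#(N (T (l 0))) : ℝ) ≤ #(T (l 0)) * (n / 100) := by
          have hsub : N (T (l 0)) ⊆ (T (l 0)).biUnion fun a => B.filter (G.Adj a) := by
            intro b hb
            simp only [N, mem_filter, mem_biUnion] at hb ⊢
            obtain ⟨hbB, a, ha, hab⟩ := hb
            exact ⟨a, ha, hbB, hab⟩
          calc (#(N (T (l 0))) : ℝ) ≤ ((∑ a ∈ T (l 0), #(B.filter (G.Adj a)) : ℕ) : ℝ) := by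
                exact_mod_cast (card_le_card hsub).trans card_biUnion_le
            _ ≤ _ := by
              push_cast
              rw [← nsmul_eq_mul]
              exact sum_le_card_nsmul _ _ _ fun a ha => hdeg a (hTA _ ha)
        simp only [f, l, pow_zero, div_one] at hN ⊢
        linarith
      | succ s ih =>
        have h := hTmax (l s) (T (l (s + 1))) (hTA _)
        have hk : (#(T (l (s + 1))) : ℝ) ≤ 8 * 2 ^ (s + 1) := by exact_mod_cast (hbig (s + 1)).le
        have hl : l s - l (s + 1) = 3 * l (s + 1) := by
          simp only [l, pow_succ]; field_simp; ring
        have hlpos : 0 ≤ l (s + 1) := by simp only [l]; positivity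
        have hstep : f (l (s + 1)) (T (l (s + 1))) ≤
            f (l s) (T (l s)) + 3 * l (s + 1) * (8 * 2 ^ (s + 1)) := by
          have hmul : 3 * l (s + 1) * #(T (l (s + 1))) ≤ 3 * l (s + 1) * (8 * 2 ^ (s + 1)) := by
            gcongr
          rw [← hl] at hmul ⊢
          simp only [f] at h ⊢
          linarith
        have hval : 3 * l (s + 1) * (8 * 2 ^ (s + 1)) = 24 / 100 * n * (1 / 2 ^ (s + 1)) := by
          have : (4 : ℝ) ^ (s + 1) = 2 ^ (s + 1) * 2 ^ (s + 1) := by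
            rw [← mul_pow]; norm_num
          simp only [l, this]; field_simp; ring
        have hhalf : (1 : ℝ) / 2 ^ s = 2 * (1 / 2 ^ (s + 1)) := by
          rw [pow_succ]; field_simp
        rw [hhalf] at ih
        rw [hval] at hstep
        linarith
    obtain ⟨s, hs⟩ := pow_unbounded_of_one_lt (n / 100 * #A) (by norm_num : (1 : ℝ) < 4)
    have hsmall : l s * #A ≤ 1 := by
      have : l s * #A = n / 100 * #A / 4 ^ s := by simp only [l]; ring
      rw [this, div_le_one (by positivity)]
      exact hs.le
    have hNA : N A = B := filter_true_of_mem hcov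
    have h1 := hTmax (l s) A subset_rfl
    have h2 := hsum s
    have h3 : (0 : ℝ) < 1 / 2 ^ s := by positivity
    simp only [f, hNA] at h1 h2
    nlinarith

/-- A triangle-free graph on `I` has a stable set of size at least the cube root of `#I`. -/
lemma exists_stable_of_triangleFree {Q : SimpleGraph V} {I : Finset V} (hI : 8 ≤ #I)
    (htri : ∀ i ∈ I, ∀ j ∈ I, ∀ k ∈ I, Q.Adj i j → Q.Adj j k → ¬ Q.Adj i k) :
    ∃ J ⊆ I, (∀ i ∈ J, ∀ j ∈ J, ¬ Q.Adj i j) ∧ 2 ≤ #J ∧ #I ≤ #J ^ 3 := by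
  let F := I.powerset.filter fun J => ∀ i ∈ J, ∀ j ∈ J, ¬ Q.Adj i j
  obtain ⟨J, hJ, hmax⟩ := exists_max_image F card ⟨∅, by simp [F]⟩
  simp only [F, mem_filter, mem_powerset] at hJ hmax
  obtain ⟨hJI, hJs⟩ := hJ
  have hcover : I ⊆ J ∪ J.biUnion fun j => I.filter (Q.Adj j) := by
    intro i hi
    by_contra hno
    simp only [mem_union, mem_biUnion, mem_filter, hi, true_and, not_or, not_exists, not_and]
      at hno
    obtain ⟨hiJ, hno⟩ := hno
    have := hmax (insert i J) ⟨insert_subset hi hJI, fun x hx y hy h => by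
      rcases mem_insert.1 hx with hx' | hx' <;> rcases mem_insert.1 hy with hy' | hy'
      · exact h.ne (hx'.trans hy'.symm)
      · exact hno y hy' (hx' ▸ h.symm)
      · exact hno x hx' (hy' ▸ h)
      · exact hJs x hx' y hy' h⟩
    rw [card_insert_of_notMem hiJ] at this
    omega
  have hdeg : ∀ j ∈ J, #(I.filter (Q.Adj j)) ≤ #J := fun j hj =>
    hmax _ ⟨filter_subset _ _, fun x hx y hy h => by
      rw [mem_filter] at hx hy
      exact htri j (hJI hj) x hx.1 y hy.1 hx.2 h hy.2⟩
  have hcard : #I ≤ #J + #J * #J := by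
    refine (card_le_card hcover).trans ((card_union_le _ _).trans ?_)
    gcongr
    exact card_biUnion_le_card_mul _ _ _ hdeg
  have h2 : 2 ≤ #J := by
    by_contra! h
    have : #J ≤ 1 := by omega
    nlinarith
  exact ⟨J, hJI, hJs, h2, by nlinarith [Nat.mul_le_mul h2 h2]⟩

end Comb

section Sparse

open scoped Classical

/-- A linked set whose neighbourhood and non-neighbourhood in `S` are both large. -/
lemma exists_balanced_linked {G : SimpleGraph V} {S : Finset V} (hS : 100 ≤ #S)
    (hdeg : ∀ v ∈ S, (#(S.filter (G.Adj v)) : ℝ) ≤ #S / 100)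
    (hpair : NoAnticompletePair G S (#S / 20)) :
    ∃ K ⊆ S, Linked G K ∧
      (#S : ℝ) / 4 ≤ #(S.filter fun v => v ∉ K ∧ ∃ k ∈ K, G.Adj k v) ∧
      (#S : ℝ) / 2 ≤ #(S.filter fun v => v ∉ K ∧ ∀ k ∈ K, ¬ G.Adj k v) := by
  have hSR : (100 : ℝ) ≤ #S := by exact_mod_cast hS
  obtain ⟨D, hDS, hDl, -, hDn⟩ :=
    hpair.exists_large_component (by linarith) subset_rfl (by linarith)
  let N : Finset V → Finset V := fun K => S.filter fun v => v ∈ K ∨ ∃ k ∈ K, G.Adj k v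
  let F := D.powerset.filter fun K : Finset V => Linked G K ∧ (#(N K) : ℝ) ≤ #S / 2
  have hF : F.Nonempty := by
    obtain ⟨d, hd⟩ := hDl.1
    refine ⟨{d}, ?_⟩
    simp only [F, mem_filter, mem_powerset, singleton_subset_iff]
    refine ⟨hd, linked_singleton G d, ?_⟩
    have hsub : N {d} ⊆ insert d (S.filter (G.Adj d)) := by
      intro v hv
      simp only [N, mem_filter, mem_singleton, exists_eq_left, mem_insert] at hv ⊢
      tauto
    have h1 : (#(N {d}) : ℝ) ≤ #(S.filter (G.Adj d)) + 1 := by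
      exact_mod_cast (card_le_card hsub).trans (card_insert_le _ _)
    linarith [hdeg d (hDS hd)]
  obtain ⟨K, hK, hmax⟩ := exists_max_image F card hF
  simp only [F, mem_filter, mem_powerset] at hK hmax
  obtain ⟨hKD, hKl, hKN⟩ := hK
  have hKS := hKD.trans hDS
  set M := S.filter fun v => v ∉ K ∧ ∃ k ∈ K, G.Adj k v
  set L := S.filter fun v => v ∉ K ∧ ∀ k ∈ K, ¬ G.Adj k v
  have hL : (#S : ℝ) / 2 ≤ #L := by
    have hsub : S ⊆ N K ∪ L := by
      intro v hv
      simp only [N, L, mem_union, mem_filter, hv, true_and]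
      by_cases h : ∃ k ∈ K, G.Adj k v
      · exact Or.inl (Or.inr h)
      · push Not at h
        tauto
    have : (#S : ℝ) ≤ #(N K) + #L := by
      exact_mod_cast (card_le_card hsub).trans (card_union_le _ _)
    linarith
  have hKsmall : (#K : ℝ) < #S / 20 := by
    refine hpair L (filter_subset _ _) K hKS ?_ ?_ (by linarith)
    · exact disjoint_left.2 fun v hv hvK => (mem_filter.1 hv).2.1 hvK
    · exact fun a ha b hb h => (mem_filter.1 (mem_coe.1 ha)).2.2 b hb h.symm
  refine ⟨K, hKS, hKl, ?_, hL⟩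
  have hKne : K ≠ D := by
    rintro rfl
    linarith
  obtain ⟨k, hk, d, hd, hkd⟩ := hDl.2 K hKD hKl.1 hKne
  rw [mem_sdiff] at hd
  have hgt : (#S : ℝ) / 2 < #(N (insert d K)) := by
    by_contra! hle
    have := hmax (insert d K) ⟨insert_subset hd.1 hKD, hKl.insert hk hkd, hle⟩
    rw [card_insert_of_notMem hd.2] at this
    omega
  have hsub : N (insert d K) ⊆ (K ∪ M) ∪ insert d (S.filter (G.Adj d)) := by
    intro v hv
    simp only [N, M, mem_filter, mem_union, mem_insert, exists_eq_or_imp] at hv ⊢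
    by_cases hvK : v ∈ K
    · exact Or.inl (Or.inl hvK)
    · simp only [hvK, or_false, false_or, not_false_eq_true, true_and] at hv ⊢
      obtain ⟨hvS, h | h | h⟩ := hv
      · exact Or.inr (Or.inl h)
      · exact Or.inr (Or.inr ⟨hvS, h⟩)
      · exact Or.inl ⟨hvS, h⟩
  have h1 : (#(N (insert d K)) : ℝ) ≤ #K + #M + (#(S.filter (G.Adj d)) + 1) := by
    exact_mod_cast (card_le_card hsub).trans ((card_union_le _ _).trans
      (Nat.add_le_add (card_union_le _ _) (card_insert_le _ _)))
  linarith [hdeg d (hDS hd.1)]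

/-- In a sparse graph without linear anticomplete pairs and without holes with hats, there are
many large disjoint sets such that each is a union of homogeneous pieces with respect to the
others and no triangle meets three of them. -/
lemma exists_teeth {G : SimpleGraph V} (hG : HoleWithHatFree G) {S : Finset V} (hS : 100 ≤ #S)
    (hdeg : ∀ v ∈ S, (#(S.filter (G.Adj v)) : ℝ) ≤ #S / 100)
    (hpair : NoAnticompletePair G S (#S / 20)) :
    ∃ (T : Finset V) (X : V → Finset V), 8 ≤ #T ∧
      (∀ i ∈ T, X i ⊆ S ∧ (#S : ℝ) / 100 ≤ #(X i) * (#T : ℝ) ^ 2 ∧ #(X i) < #S) ∧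
      (∀ i ∈ T, ∀ j ∈ T, i ≠ j → Disjoint (X i) (X j)) ∧
      (∀ i ∈ T, ∀ j ∈ T, i ≠ j → ∀ x ∈ X i, ∀ x' ∈ X i, ∀ y ∈ X j,
        G.Adj x x' → G.Adj x y → G.Adj x' y) ∧
      (∀ i ∈ T, ∀ j ∈ T, ∀ k ∈ T, i ≠ j → j ≠ k → i ≠ k → ∀ x ∈ X i, ∀ y ∈ X j, ∀ z ∈ X k,
        G.Adj x y → G.Adj y z → ¬ G.Adj x z) := by
  have hSR : (100 : ℝ) ≤ #S := by exact_mod_cast hS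
  obtain ⟨K, hKS, hKl, hM, hL⟩ := exists_balanced_linked hS hdeg hpair
  set M := S.filter fun v => v ∉ K ∧ ∃ k ∈ K, G.Adj k v
  set L := S.filter fun v => v ∉ K ∧ ∀ k ∈ K, ¬ G.Adj k v
  let B := L.filter fun v => ∃ m ∈ M, G.Adj m v
  have hMS : M ⊆ S := filter_subset _ _
  have hLS : L ⊆ S := filter_subset _ _
  have hBL : B ⊆ L := filter_subset _ _
  have hML : Disjoint M L := disjoint_left.2 fun v hv hv' => by
    obtain ⟨-, -, k, hk, hkv⟩ := mem_filter.1 hv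
    exact (mem_filter.1 hv').2.2 k hk hkv
  have hL0 : (#(L.filter fun v => ¬ ∃ m ∈ M, G.Adj m v) : ℝ) < #S / 20 := by
    refine hpair M hMS _ ((filter_subset _ _).trans hLS) ?_ ?_ (by linarith)
    · exact disjoint_of_subset_right (filter_subset _ _) hML
    · intro a ha b hb h
      exact (mem_filter.1 (mem_coe.1 hb)).2 ⟨a, ha, h⟩
  have hB : 2 / 5 * (#S : ℝ) ≤ #B := by
    have : (#B : ℝ) + #(L.filter fun v => ¬ ∃ m ∈ M, G.Adj m v) = #L := by
      exact_mod_cast card_filter_add_card_filter_not _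
    linarith
  have hdegB : ∀ a ∈ M, (#(B.filter (G.Adj a)) : ℝ) ≤ #S / 100 := fun a ha =>
    le_trans (by exact_mod_cast card_le_card (filter_subset_filter _ (hBL.trans hLS)))
      (hdeg a (hMS ha))
  obtain ⟨T, hTM, hT, hcomb⟩ :=
    exists_comb hSR hdegB (fun b hb => (mem_filter.1 hb).2) hB
  let X : V → Finset V := fun a => B.filter fun b => G.Adj a b ∧ ∀ a' ∈ T, a' ≠ a → ¬ G.Adj a' b
  have hXB : ∀ i, X i ⊆ B := fun i => filter_subset _ _
  have hXadj : ∀ i, ∀ x ∈ X i, G.Adj i x := fun i x hx => (mem_filter.1 hx).2.1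
  have hXnadj : ∀ i, ∀ x ∈ X i, ∀ j ∈ T, j ≠ i → ¬ G.Adj j x :=
    fun i x hx => (mem_filter.1 hx).2.2
  have hLK : ∀ x ∈ L, ∀ k ∈ K, x ≠ k ∧ ¬ G.Adj x k := by
    intro x hx k hk
    obtain ⟨-, hxK, hxn⟩ := mem_filter.1 hx
    exact ⟨fun h => hxK (h ▸ hk), fun h => hxn k hk h.symm⟩
  have hXK : ∀ i, ∀ x ∈ X i, ∀ k ∈ K, x ≠ k ∧ ¬ G.Adj x k := fun i x hx => hLK x (hBL (hXB i hx))
  have hatt : ∀ m ∈ T, ∃ k ∈ K, G.Adj m k := by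
    intro m hm
    obtain ⟨-, -, k, hk, hkm⟩ := mem_filter.1 (hTM hm)
    exact ⟨k, hk, hkm.symm⟩
  have hXT : ∀ i, ∀ x ∈ X i, ∀ m ∈ T, x ≠ m := by
    rintro i x hx m hm rfl
    exact disjoint_left.1 hML (hTM hm) (hBL (hXB i hx))
  have hdisj : ∀ i ∈ T, ∀ j, i ≠ j → Disjoint (X i) (X j) := fun i hi j hij =>
    disjoint_left.2 fun x hx hx' => hXnadj j x hx' i hi hij (hXadj i x hx)
  have hole : ∀ i ∈ T, ∀ j ∈ T, i ≠ j → ∀ x ∈ X i, ∀ y ∈ X j, G.Adj x y → ∀ l, ∀ w ∈ X l,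
      j ≠ l → w ≠ x → w ≠ y → G.Adj w x → (G.Adj w i ↔ ¬ G.Adj w y) → False := by
    intro i hi j hj hij x hx y hy hxy l w hw hjl hwx hwy hwx' hiff
    refine hG (hKl.hasHoleWithHat (hatt i hi) (hatt j hj) hij (hXK i x hx) (hXK j y hy)
      (hXK l w hw) (hXadj i x hx) hxy (hXadj j y hy).symm (hXnadj j y hy i hi hij)
      (fun h => hXnadj i x hx j hj hij.symm h.symm) (hXT j y hy i hi).symm (hXT i x hx j hj)
      ⟨hXT l w hw i hi, hwx, hwy, hXT l w hw j hj⟩ hwx' ?_ hiff)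
    exact fun h => hXnadj l w hw j hj hjl h.symm
  refine ⟨T, X, hT, fun i hi => ⟨(hXB i).trans (hBL.trans hLS), hcomb i hi, ?_⟩,
    fun i hi j _ => hdisj i hi j, ?_, ?_⟩
  · have h1 : (#(X i) : ℝ) ≤ #S / 100 := by
      refine le_trans ?_ (hdegB i (hTM hi))
      exact_mod_cast card_le_card fun b (hb : b ∈ X i) =>
        mem_filter.2 ⟨hXB i hb, hXadj i b hb⟩
    exact_mod_cast (by linarith : (#(X i) : ℝ) < #S)
  · intro i hi j hj hij x hx x' hx' y hy hxx' hxy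
    by_contra hno
    refine hole i hi j hj hij x hx y hy hxy i x' hx' hij.symm hxx'.ne' ?_ hxx'.symm ?_
    · rintro rfl
      exact disjoint_left.1 (hdisj i hi j hij) hx' hy
    · simp [hno, (hXadj i x' hx').symm]
  · intro i hi j hj k hk hij hjk hik x hx y hy z hz hxy hyz hxz
    refine hole i hi j hj hij x hx y hy hxy k z hz hjk hxz.ne' hyz.ne' hxz.symm ?_
    have : ¬ G.Adj z i := fun h => hXnadj k z hz i hi hik h.symm
    simp [this, hyz.symm]

/-- A sparse graph without linear anticomplete pairs contains an induced five-vertex path. -/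
lemma exists_induced_path_five {G : SimpleGraph V} {S : Finset V} (hS : 100 ≤ #S)
    (hdeg : ∀ v ∈ S, (#(S.filter (G.Adj v)) : ℝ) ≤ #S / 100)
    (hpair : NoAnticompletePair G S (#S / 20)) :
    ∃ p : Fin 5 → V, ∀ i j, i < j → p i ≠ p j ∧ (G.Adj (p i) (p j) ↔ j.val = i.val + 1) := by
  have hSR : (100 : ℝ) ≤ #S := by exact_mod_cast hS
  have step : ∀ D ⊆ S, ∀ v ∈ S, v ∉ D → Linked G D → (∃ d ∈ D, G.Adj v d) →
      (#S : ℝ) / 4 ≤ #D → ∃ u ∈ D, G.Adj v u ∧ ∃ D' ⊆ D, u ∉ D' ∧ Linked G D' ∧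
        (∃ d ∈ D', G.Adj u d) ∧ (#D : ℝ) - #S * (11 / 100) ≤ #D' ∧
        ∀ d ∈ D', v ≠ d ∧ ¬ G.Adj v d := by
    intro D hDS v hvS hvD hDl ⟨d, hd, hvd⟩ hDn
    set W := D.filter fun x => ¬ G.Adj v x
    have hW : (#D : ℝ) - #S / 100 ≤ #W := by
      have h1 : (#(D.filter (G.Adj v)) : ℝ) + #W = #D := by
        exact_mod_cast card_filter_add_card_filter_not _
      have h2 : (#(D.filter (G.Adj v)) : ℝ) ≤ #(S.filter (G.Adj v)) := by
        exact_mod_cast card_le_card (filter_subset_filter _ hDS)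
      linarith [hdeg v hvS]
    obtain ⟨D', hD'W, hD'l, hD'c, hD'n⟩ := hpair.exists_large_component (W := W)
      (by linarith) ((filter_subset _ _).trans hDS) (by linarith)
    have hD'D : D' ⊆ D := hD'W.trans (filter_subset _ _)
    have hne : D' ≠ D := by
      rintro rfl
      exact (mem_filter.1 (hD'W hd)).2 hvd
    obtain ⟨a, ha, u, hu, hau⟩ := hDl.2 D' hD'D hD'l.1 hne
    rw [mem_sdiff] at hu
    refine ⟨u, hu.1, ?_, D', hD'D, hu.2, hD'l, ⟨a, ha, hau.symm⟩, by linarith, ?_⟩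
    · by_contra hvu
      exact hD'c a ha u (by simp [W, hu.1, hu.2, hvu]) hau
    · exact fun x hx => ⟨fun h => hvD (h ▸ hD'D hx), (mem_filter.1 (hD'W hx)).2⟩
  obtain ⟨D, hDS, hDl, -, hDn⟩ :=
    hpair.exists_large_component (by linarith) subset_rfl (by linarith)
  obtain ⟨v₀, hv₀⟩ := hDl.1
  obtain ⟨D₀, hD₀D, hv₀D₀, hD₀l, hatt₀, hD₀n⟩ : ∃ D₀ ⊆ D, v₀ ∉ D₀ ∧ Linked G D₀ ∧
      (∃ d ∈ D₀, G.Adj v₀ d) ∧ (#D : ℝ) - #S * (11 / 100) ≤ #D₀ := by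
    have hW : (#(D.erase v₀) : ℝ) = #D - 1 := by
      rw [card_erase_of_mem hv₀, Nat.cast_sub (card_pos.2 ⟨v₀, hv₀⟩), Nat.cast_one]
    obtain ⟨D₀, hD₀, hD₀l, hD₀c, hD₀n⟩ := hpair.exists_large_component (W := D.erase v₀)
      (by linarith) ((erase_subset _ _).trans hDS) (by linarith)
    have hv : v₀ ∉ D₀ := fun h => by simpa using hD₀ h
    have hD₀D : D₀ ⊆ D := hD₀.trans (erase_subset _ _)
    obtain ⟨a, ha, u, hu, hau⟩ := hDl.2 D₀ hD₀D hD₀l.1 (by rintro rfl; exact hv hv₀)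
    rw [mem_sdiff] at hu
    have huv : u = v₀ := by
      by_contra huv
      exact hD₀c a ha u (by simp [hu.1, hu.2, huv]) hau
    exact ⟨D₀, hD₀D, hv, hD₀l, ⟨a, ha, huv ▸ hau.symm⟩, by linarith⟩
  have hD₀S := hD₀D.trans hDS
  obtain ⟨v₁, hv₁, h01, D₁, hD₁, hv₁D₁, hD₁l, hatt₁, hD₁n, hfar₀⟩ :=
    step D₀ hD₀S v₀ (hDS hv₀) hv₀D₀ hD₀l hatt₀ (by linarith)
  obtain ⟨v₂, hv₂, h12, D₂, hD₂, hv₂D₂, hD₂l, hatt₂, hD₂n, hfar₁⟩ :=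
    step D₁ (hD₁.trans hD₀S) v₁ (hD₀S hv₁) hv₁D₁ hD₁l hatt₁ (by linarith)
  obtain ⟨v₃, hv₃, h23, D₃, hD₃, hv₃D₃, hD₃l, ⟨v₄, hv₄, h34⟩, hD₃n, hfar₂⟩ :=
    step D₂ (hD₂.trans (hD₁.trans hD₀S)) v₂ (hD₀S (hD₁ hv₂)) hv₂D₂ hD₂l hatt₂ (by linarith)
  have h02 := hfar₀ v₂ hv₂
  have h03 := hfar₀ v₃ (hD₂ hv₃)
  have h04 := hfar₀ v₄ (hD₂ (hD₃ hv₄))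
  have h13 := hfar₁ v₃ hv₃
  have h14 := hfar₁ v₄ (hD₃ hv₄)
  have h24 := hfar₂ v₄ hv₄
  refine ⟨![v₀, v₁, v₂, v₃, v₄], fun i j hij => ?_⟩
  fin_cases i <;> fin_cases j <;> simp at hij <;>
    simp [h01, h12, h23, h34, h02, h03, h04, h13, h14, h24, h01.ne, h12.ne, h23.ne, h34.ne]

end Sparse

section Rodl

open scoped Classical

/-- Every vertex of `A` has at most a `c`-fraction of `B` as neighbours. -/
def SparsePair (G : SimpleGraph V) (c : ℝ) (A B : Finset V) : Prop :=
  ∀ a ∈ A, (#(B.filter (G.Adj a)) : ℝ) ≤ c * #B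

/-- No two disjoint subsets of `U` of size at least `s` form a `c`-sparse pair. -/
def NoSparsePair (G : SimpleGraph V) (c : ℝ) (U : Finset V) (s : ℝ) : Prop :=
  ∀ A ⊆ U, ∀ B ⊆ U, Disjoint A B → s ≤ #A → s ≤ #B → ¬ SparsePair G c A B

/-- Without sparse pairs in a graph or its complement, every graph embeds with prescribed large
disjoint parts. -/
lemma exists_embedding {c : ℝ} (hc : 0 < c) (hc1 : c < 1) (h : ℕ) :
    ∃ r : ℝ, 1 ≤ r ∧ ∀ {V : Type} (G : SimpleGraph V) (U : Finset V) (s : ℝ), 0 < s →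
      NoSparsePair G c U s → NoSparsePair Gᶜ c U s →
      ∀ (H : SimpleGraph (Fin h)) (W : Fin h → Finset V), (∀ i, W i ⊆ U) →
        (∀ i j, i ≠ j → Disjoint (W i) (W j)) → (∀ i, r * s ≤ #(W i)) →
        ∃ f : Fin h → V, (∀ i, f i ∈ W i) ∧ ∀ i j, i ≠ j → (G.Adj (f i) (f j) ↔ H.Adj i j) := by
  induction h with
  | zero => exact ⟨1, le_rfl, fun _ _ _ _ _ _ _ _ _ _ _ => ⟨Fin.elim0, fun i => i.elim0,
      fun i => i.elim0⟩⟩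
  | succ h ih =>
    obtain ⟨r, hr, ih⟩ := ih
    have hrc : r ≤ r / c := le_div_self (by linarith) hc hc1.le
    refine ⟨r / c + h + 1, by linarith [Nat.cast_nonneg (α := ℝ) h], ?_⟩
    intro V G U s hs hG hGc H W hWU hW hWs
    have hWs' : ∀ i, r / c * s ≤ #(W i) ∧ h * s + s ≤ #(W i) := by
      intro i
      have := hWs i
      have h1 : (0 : ℝ) ≤ h * s := by positivity
      have h2 : 0 ≤ r / c * s := by positivity
      constructor <;> nlinarith
    let Q : Fin h → SimpleGraph V := fun j => if H.Adj 0 j.succ then G else Gᶜ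
    let bad : Fin h → Finset V := fun j =>
      (W 0).filter fun v => (#((W j.succ).filter ((Q j).Adj v)) : ℝ) ≤ c * #(W j.succ)
    have hbad : ∀ j, (#(bad j) : ℝ) ≤ s := by
      intro j
      by_contra! hlt
      have hsp : SparsePair (Q j) c (bad j) (W j.succ) := fun a ha => (mem_filter.1 ha).2
      have hd : Disjoint (bad j) (W j.succ) :=
        disjoint_of_subset_left (filter_subset _ _) (hW _ _ (Fin.succ_ne_zero j).symm)
      have hsub : bad j ⊆ U := (filter_subset _ _).trans (hWU 0)
      have hbig : s ≤ #(W j.succ) := by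
        have h1 : (0 : ℝ) ≤ h * s := by positivity
        linarith [(hWs' j.succ).2]
      by_cases hH : H.Adj 0 j.succ
      · simp only [Q, hH, if_true] at hsp
        exact hG _ hsub _ (hWU _) hd hlt.le hbig hsp
      · simp only [Q, hH, if_false] at hsp
        exact hGc _ hsub _ (hWU _) hd hlt.le hbig hsp
    have hcard : #(univ.biUnion bad) < #(W 0) := by
      have h1 : (#(univ.biUnion bad) : ℝ) ≤ ∑ j, (#(bad j) : ℝ) := by
        exact_mod_cast card_biUnion_le
      have h2 : ∑ j, (#(bad j) : ℝ) ≤ h * s := by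
        simpa using sum_le_sum fun j (_ : j ∈ univ) => hbad j
      exact_mod_cast (by linarith [(hWs' 0).2] : (#(univ.biUnion bad) : ℝ) < #(W 0))
    obtain ⟨v, hv, hvbad⟩ := exists_mem_notMem_of_card_lt_card hcard
    simp only [mem_biUnion, mem_univ, true_and, not_exists, bad, mem_filter, not_and, not_le]
      at hvbad
    obtain ⟨f, hf, hfH⟩ := ih G U s hs hG hGc (H.comap Fin.succ)
      (fun j => (W j.succ).filter ((Q j).Adj v)) (fun j => (filter_subset _ _).trans (hWU _))
      (fun i j hij => disjoint_filter_filter (hW _ _ (by simpa using hij))) (by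
        intro j
        refine le_trans ?_ (hvbad j hv).le
        have := (hWs' j.succ).1
        calc r * s = c * (r / c * s) := by field_simp
          _ ≤ _ := by gcongr)
    have hv' : ∀ j, G.Adj v (f j) ↔ H.Adj 0 j.succ := by
      intro j
      have := (mem_filter.1 (hf j)).2
      by_cases hH : H.Adj 0 j.succ
      · simp only [Q, hH, if_true] at this
        simp [hH, this]
      · simp only [Q, hH, if_false, SimpleGraph.compl_adj] at this
        simp [hH, this]
    refine ⟨Fin.cons v f, ?_, ?_⟩
    · intro i
      cases i using Fin.cases with
      | zero => simpa using hv
      | succ j => simpa using (mem_filter.1 (hf j)).1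
    · intro i j hij
      cases i using Fin.cases with
      | zero =>
        cases j using Fin.cases with
        | zero => exact absurd rfl hij
        | succ j => simpa using hv' j
      | succ i =>
        cases j using Fin.cases with
        | zero => simpa [G.adj_comm, H.adj_comm] using hv' i
        | succ j => simpa using hfH i j (by simpa using hij)

lemma HoleWithHatFree.false_of_house {G : SimpleGraph V} (hG : HoleWithHatFree G) (f : Fin 5 → V)
    (hf : ∀ i j, i ≠ j → f i ≠ f j)
    (hadj : ∀ i j, i ≠ j → (G.Adj (f i) (f j) ↔ ¬ (j.val = i.val + 1 ∨ i.val = j.val + 1))) :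
    False := by
  refine hG (hasHoleWithHat_of_seq (n := 4) le_rfl (fun n => f (![0, 3, 1, 4] (Fin.ofNat 4 n)))
    (f 2) 3 (by norm_num) ?_ ?_ ?_ ?_)
  · intro i j hij hj
    interval_cases j <;> interval_cases i <;> exact hf _ _ (by decide)
  · intro i j hij hj
    interval_cases j <;> interval_cases i <;> (rw [hadj _ _ (by decide)]; decide)
  · intro j hj
    interval_cases j <;> exact hf _ _ (by decide)
  · intro j hj
    interval_cases j <;> (rw [hadj _ _ (by decide)]; decide)

lemma exists_disjoint_family (h m : ℕ) : ∀ U : Finset V, h * m ≤ #U →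
    ∃ W : Fin h → Finset V, (∀ i, W i ⊆ U ∧ #(W i) = m) ∧ ∀ i j, i ≠ j → Disjoint (W i) (W j) := by
  induction h with
  | zero => exact fun _ _ => ⟨Fin.elim0, fun i => i.elim0, fun i => i.elim0⟩
  | succ h ih =>
    intro U hU
    rw [Nat.succ_mul] at hU
    obtain ⟨A, hAU, hA⟩ := exists_subset_card_eq (show m ≤ #U by omega)
    obtain ⟨W, hW, hd⟩ := ih (U \ A) (by rw [card_sdiff_of_subset hAU]; omega)
    have hAW : ∀ i, Disjoint A (W i) := fun i =>
      disjoint_of_subset_right (hW i).1 disjoint_sdiff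
    refine ⟨Fin.cons A W, ?_, ?_⟩
    · intro i
      cases i using Fin.cases with
      | zero => exact ⟨hAU, hA⟩
      | succ i => exact ⟨(hW i).1.trans sdiff_subset, (hW i).2⟩
    · intro i j hij
      cases i using Fin.cases with
      | zero =>
        cases j using Fin.cases with
        | zero => exact absurd rfl hij
        | succ j => exact hAW j
      | succ i =>
        cases j using Fin.cases with
        | zero => exact (hAW i).symm
        | succ j => exact hd i j (by simpa using hij)

lemma exists_sparsePair {c : ℝ} (hc : 0 < c) (hc1 : c < 1) :
    ∃ δ : ℝ, 0 < δ ∧ ∃ N : ℕ, ∀ {V : Type} {G : SimpleGraph V}, HoleWithHatFree G →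
      ∀ U : Finset V, N ≤ #U → ∃ A ⊆ U, ∃ B ⊆ U, Disjoint A B ∧ δ * #U ≤ #A ∧ #A ≤ #B ∧
        (SparsePair G c A B ∨ SparsePair Gᶜ c A B) := by
  obtain ⟨r, hr, hemb⟩ := exists_embedding hc hc1 5
  have hr0 : 0 < r := by linarith
  refine ⟨1 / (10 * r), by positivity, 10, ?_⟩
  intro V G hG U hU
  set s : ℝ := 1 / (10 * r) * #U with hs_def
  have hUpos : (10 : ℝ) ≤ #U := by exact_mod_cast hU
  have hs : 0 < s := by positivity
  have shrink : ∀ Q : SimpleGraph V, ¬ NoSparsePair Q c U s → ∃ A ⊆ U, ∃ B ⊆ U, Disjoint A B ∧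
      s ≤ #A ∧ #A ≤ #B ∧ SparsePair Q c A B := by
    intro Q hQ
    simp only [NoSparsePair, not_forall, not_not] at hQ
    obtain ⟨A, hA, B, hB, hd, hsA, hsB, hsp⟩ := hQ
    obtain ⟨A', hA', hcard⟩ := exists_subset_card_eq (min_le_left #A #B)
    refine ⟨A', hA'.trans hA, B, hB, disjoint_of_subset_left hA' hd, ?_, ?_,
      fun a ha => hsp a (hA' ha)⟩
    · rw [hcard, Nat.cast_min]
      exact le_min hsA hsB
    · rw [hcard]
      exact min_le_right _ _
  by_cases h1 : NoSparsePair G c U s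
  · by_cases h2 : NoSparsePair Gᶜ c U s
    · exfalso
      obtain ⟨W, hW, hd⟩ := exists_disjoint_family 5 (#U / 5) U (by omega)
      obtain ⟨f, hf, hadj⟩ := hemb G U s hs h1 h2 house W (fun i => (hW i).1) hd (by
        intro i
        have h3 : #U ≤ 10 * (#U / 5) := by omega
        have h4 : (#U : ℝ) ≤ 10 * (#U / 5 : ℕ) := by exact_mod_cast h3
        rw [(hW i).2, hs_def]
        calc r * (1 / (10 * r) * #U) = #U / 10 := by field_simp
          _ ≤ _ := by linarith)
      refine hG.false_of_house f (fun i j hij h => ?_) fun i j hij => ?_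
      · exact disjoint_left.1 (hd i j hij) (hf i) (h ▸ hf j)
      · rw [hadj i j hij, house, SimpleGraph.compl_adj, SimpleGraph.pathGraph_adj]
        simp only [ne_eq, hij, not_false_eq_true, true_and, eq_comm]
    · obtain ⟨A, hA, B, hB, hd, hsA, hAB, hsp⟩ := shrink _ h2
      exact ⟨A, hA, B, hB, hd, hsA, hAB, Or.inr hsp⟩
  · obtain ⟨A, hA, B, hB, hd, hsA, hAB, hsp⟩ := shrink _ h1
    exact ⟨A, hA, B, hB, hd, hsA, hAB, Or.inl hsp⟩

lemma exists_subset_sum_le_average (f : V → ℝ) (s n : ℕ) : ∀ B : Finset V, #B = s + n →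
    ∃ B' ⊆ B, #B' = s ∧ #B * ∑ b ∈ B', f b ≤ s * ∑ b ∈ B, f b := by
  induction n with
  | zero => exact fun B hB => ⟨B, subset_rfl, hB, by rw [hB]; simp⟩
  | succ n ih =>
    intro B hB
    obtain ⟨x, hx, hmax⟩ := exists_max_image B f (card_pos.1 (by omega))
    obtain hsn | hsn := Nat.eq_zero_or_pos (s + n)
    · exact ⟨∅, empty_subset _, by simp; omega, by simp [show s = 0 by omega]⟩
    have hcard : #(B.erase x) = s + n := by rw [card_erase_of_mem hx]; omega
    obtain ⟨B', hB', hs, hle⟩ := ih _ hcard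
    refine ⟨B', hB'.trans (erase_subset _ _), hs, ?_⟩
    have hsum := add_sum_erase B f hx
    have hav : ∑ b ∈ B, f b ≤ #B * f x := by
      simpa using sum_le_sum fun b hb => hmax b hb
    rw [hcard] at hle
    rw [hB] at hav ⊢
    have hpos : (0 : ℝ) < (s + n : ℕ) := by exact_mod_cast hsn
    refine le_of_mul_le_mul_left ?_ hpos
    have h1 : ((s + (n + 1) : ℕ) : ℝ) = (s + n : ℕ) + 1 := by push_cast; ring
    rw [h1] at hav ⊢
    set m : ℝ := ((s + n : ℕ) : ℝ)
    have h2 : (m + 1) * ∑ b ∈ B.erase x, f b ≤ m * ∑ b ∈ B, f b := by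
      rw [← hsum] at hav ⊢
      linarith
    have h3 := mul_le_mul_of_nonneg_left h2 (Nat.cast_nonneg (α := ℝ) s)
    have h4 := mul_le_mul_of_nonneg_left hle (by linarith : 0 ≤ m + 1)
    linarith

/-- The number of ordered adjacent pairs in `A ×ˢ B`. -/
noncomputable def edgeCount (G : SimpleGraph V) (A B : Finset V) : ℕ :=
  ∑ a ∈ A, #(B.filter (G.Adj a))

lemma edgeCount_comm (G : SimpleGraph V) (A B : Finset V) :
    edgeCount G A B = edgeCount G B A := by
  simp only [edgeCount, card_filter]
  rw [sum_comm]
  simp only [G.adj_comm]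

lemma edgeCount_union_left (G : SimpleGraph V) {A A' : Finset V} (h : Disjoint A A')
    (B : Finset V) : edgeCount G (A ∪ A') B = edgeCount G A B + edgeCount G A' B :=
  sum_union h

lemma edgeCount_union_self (G : SimpleGraph V) {A B : Finset V} (h : Disjoint A B) :
    edgeCount G (A ∪ B) (A ∪ B) = edgeCount G A A + 2 * edgeCount G A B + edgeCount G B B := by
  rw [edgeCount_union_left G h, edgeCount_comm G A (A ∪ B), edgeCount_comm G B (A ∪ B),
    edgeCount_union_left G h, edgeCount_union_left G h, edgeCount_comm G B A]
  ring

lemma edgeCount_le (G : SimpleGraph V) (A B : Finset V) : edgeCount G A B ≤ #A * #B := by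
  simpa [edgeCount] using sum_le_sum fun a (_ : a ∈ A) => card_filter_le B (G.Adj a)

lemma SparsePair.extend {G : SimpleGraph V} {c : ℝ} {A B S : Finset V} {a s : ℕ}
    (hsp : SparsePair G c A B) (hd : Disjoint A B) (hAB : #A ≤ #B) (hSA : S ⊆ A) (ha : 1 ≤ a)
    (hc : 0 ≤ c) (hS : #S = a * s) (he : (edgeCount G S S : ℝ) ≤ (a + c * a ^ 2) * s ^ 2) :
    ∃ B' ⊆ B, #(S ∪ B') = (a + 1) * s ∧
      (edgeCount G (S ∪ B') (S ∪ B') : ℝ) ≤ ((a + 1 : ℕ) + c * (a + 1 : ℕ) ^ 2) * s ^ 2 := by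
  have hsB : s ≤ #B := by nlinarith [card_le_card hSA]
  obtain ⟨n, hn⟩ := Nat.exists_eq_add_of_le hsB
  obtain ⟨B', hB', hs, hle⟩ :=
    exists_subset_sum_le_average (fun b => (#(S.filter (G.Adj b)) : ℝ)) s n B hn
  have hSB' : Disjoint S B' := disjoint_of_subset_left hSA (disjoint_of_subset_right hB' hd)
  have hcross : (edgeCount G S B' : ℝ) ≤ c * a * s ^ 2 := by
    obtain h0 | h0 := Nat.eq_zero_or_pos s
    · have : B' = ∅ := card_eq_zero.1 (hs.trans h0)
      simp [this, h0, edgeCount]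
    have hBpos : (0 : ℝ) < #B := by exact_mod_cast h0.trans_le hsB
    have h1 : (edgeCount G B S : ℝ) ≤ a * s * (c * #B) := by
      rw [edgeCount_comm, edgeCount]
      push_cast
      refine (sum_le_sum fun v hv => hsp v (hSA hv)).trans ?_
      simp [hS]
    have h2 : (#B : ℝ) * edgeCount G B' S ≤ s * edgeCount G B S := by
      simpa [edgeCount] using hle
    rw [edgeCount_comm]
    refine le_of_mul_le_mul_left ?_ hBpos
    have h3 := mul_le_mul_of_nonneg_left h1 (Nat.cast_nonneg (α := ℝ) s)
    linarith
  refine ⟨B', hB', by rw [card_union_of_disjoint hSB', hS, hs]; ring, ?_⟩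
  have hBB : (edgeCount G B' B' : ℝ) ≤ s ^ 2 := by
    have := edgeCount_le G B' B'
    rw [hs, ← sq] at this
    exact_mod_cast this
  rw [edgeCount_union_self G hSB']
  push_cast
  nlinarith [mul_nonneg hc (sq_nonneg (s : ℝ))]

lemma exists_few_edges {c : ℝ} (hc : 0 < c) (hc1 : c < 1) (n : ℕ) :
    ∀ a b : ℕ, 1 ≤ a → 1 ≤ b → a + b = n →
    ∃ δ : ℝ, 0 < δ ∧ ∃ N : ℕ, ∀ {V : Type} {G : SimpleGraph V}, HoleWithHatFree G →
      ∀ U : Finset V, N ≤ #U → ∃ s : ℕ, ∃ S ⊆ U, δ * #U ≤ s ∧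
        ((#S = a * s ∧ (edgeCount G S S : ℝ) ≤ (a + c * a ^ 2) * s ^ 2) ∨
          (#S = b * s ∧ (edgeCount Gᶜ S S : ℝ) ≤ (b + c * b ^ 2) * s ^ 2)) := by
  have trivial_case : ∀ {V : Type} (Q : SimpleGraph V) (U : Finset V),
      (edgeCount Q U U : ℝ) ≤ ((1 : ℕ) + c * (1 : ℕ) ^ 2) * (#U : ℝ) ^ 2 := by
    intro V Q U
    have h1 : (edgeCount Q U U : ℝ) ≤ #U * #U := by exact_mod_cast edgeCount_le Q U U
    push_cast
    nlinarith [mul_nonneg hc.le (sq_nonneg (#U : ℝ))]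
  induction n with
  | zero => intro a b ha hb; omega
  | succ n ih =>
    intro a b ha hb hab
    obtain rfl | ha' := ha.eq_or_lt
    · exact ⟨1, one_pos, 0, fun {V G} _ U _ => ⟨#U, U, subset_rfl, by simp,
        Or.inl ⟨by simp, trivial_case G U⟩⟩⟩
    obtain rfl | hb' := hb.eq_or_lt
    · exact ⟨1, one_pos, 0, fun {V G} _ U _ => ⟨#U, U, subset_rfl, by simp,
        Or.inr ⟨by simp, trivial_case Gᶜ U⟩⟩⟩
    obtain ⟨a, rfl⟩ := Nat.exists_eq_add_of_le' ha
    obtain ⟨b, rfl⟩ := Nat.exists_eq_add_of_le' hb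
    obtain ⟨δ₁, hδ₁, N₁, h₁⟩ := ih a (b + 1) (by omega) (by omega) (by omega)
    obtain ⟨δ₂, hδ₂, N₂, h₂⟩ := ih (a + 1) b (by omega) (by omega) (by omega)
    obtain ⟨δ, hδ, N, hpair⟩ := exists_sparsePair hc hc1
    refine ⟨min δ₁ δ₂ * δ, by positivity, max N ⌈((max N₁ N₂ : ℕ) : ℝ) / δ⌉₊, ?_⟩
    intro V G hG U hU
    obtain ⟨A, hA, B, hB, hd, hδA, hAB, hsp⟩ := hpair hG U ((le_max_left _ _).trans hU)
    have hNA : max N₁ N₂ ≤ #A := by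
      have h3 : ((max N₁ N₂ : ℕ) : ℝ) / δ ≤ #U :=
        (Nat.le_ceil _).trans (by exact_mod_cast (le_max_right _ _).trans hU)
      rw [div_le_iff₀ hδ] at h3
      exact_mod_cast (by linarith : ((max N₁ N₂ : ℕ) : ℝ) ≤ #A)
    have hscale : ∀ (δ' : ℝ) (s : ℕ), 0 < δ' → min δ₁ δ₂ ≤ δ' → δ' * #A ≤ s →
        min δ₁ δ₂ * δ * #U ≤ s := by
      intro δ' s hδ' hmin hs
      refine le_trans ?_ hs
      rw [mul_assoc]
      exact mul_le_mul hmin hδA (by positivity) hδ'.le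
    obtain hsp | hsp := hsp
    · obtain ⟨s, S, hSA, hs, ⟨hS, he⟩ | hS⟩ := h₁ hG A ((le_max_left _ _).trans hNA)
      · obtain ⟨B', hB', hcard, he'⟩ := hsp.extend hd hAB hSA (by omega) hc.le hS he
        exact ⟨s, S ∪ B', union_subset (hSA.trans hA) (hB'.trans hB),
          hscale δ₁ s hδ₁ (min_le_left _ _) hs, Or.inl ⟨hcard, he'⟩⟩
      · exact ⟨s, S, hSA.trans hA, hscale δ₁ s hδ₁ (min_le_left _ _) hs, Or.inr hS⟩
    · obtain ⟨s, S, hSA, hs, hS | ⟨hS, he⟩⟩ := h₂ hG A ((le_max_right _ _).trans hNA)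
      · exact ⟨s, S, hSA.trans hA, hscale δ₂ s hδ₂ (min_le_right _ _) hs, Or.inl hS⟩
      · obtain ⟨B', hB', hcard, he'⟩ := hsp.extend hd hAB hSA (by omega) hc.le hS he
        exact ⟨s, S ∪ B', union_subset (hSA.trans hA) (hB'.trans hB),
          hscale δ₂ s hδ₂ (min_le_right _ _) hs, Or.inr ⟨hcard, he'⟩⟩

lemma exists_subset_bounded_degree {G : SimpleGraph V} {S : Finset V}
    (he : (edgeCount G S S : ℝ) ≤ (#S : ℝ) ^ 2 / 400) :
    ∃ T ⊆ S, (#S : ℝ) / 2 ≤ #T ∧ ∀ v ∈ T, (#(T.filter (G.Adj v)) : ℝ) ≤ #T / 100 := by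
  set T := S.filter fun v => (#(S.filter (G.Adj v)) : ℝ) ≤ #S / 200
  set T' := S.filter fun v => ¬ (#(S.filter (G.Adj v)) : ℝ) ≤ #S / 200
  have hcard : (#T : ℝ) + #T' = #S := by exact_mod_cast card_filter_add_card_filter_not _
  have hT : (#S : ℝ) / 2 ≤ #T := by
    obtain h0 | h0 := (Nat.cast_nonneg (α := ℝ) #S).eq_or_lt
    · rw [← h0]
      simp
    have h1 : #T' * ((#S : ℝ) / 200) ≤ edgeCount G S S := by
      rw [edgeCount]
      push_cast
      calc #T' * ((#S : ℝ) / 200) = ∑ v ∈ T', (#S : ℝ) / 200 := by simp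
        _ ≤ ∑ v ∈ T', (#(S.filter (G.Adj v)) : ℝ) :=
          sum_le_sum fun v hv => (not_le.1 (mem_filter.1 hv).2).le
        _ ≤ _ := sum_le_sum_of_subset_of_nonneg (filter_subset _ _) fun _ _ _ => by positivity
    have h2 : (#T' : ℝ) ≤ #S / 2 := by
      refine le_of_mul_le_mul_right ?_ h0
      nlinarith
    linarith
  refine ⟨T, filter_subset _ _, hT, fun v hv => ?_⟩
  have h3 : (#(T.filter (G.Adj v)) : ℝ) ≤ #(S.filter (G.Adj v)) := by
    exact_mod_cast card_le_card (filter_subset_filter _ (filter_subset _ _))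
  linarith [(mem_filter.1 hv).2]

/-- Rödl's theorem for graphs without holes with hats: a linear-size subset is sparse in the graph
or in its complement. -/
lemma exists_sparse_subset :
    ∃ δ : ℝ, 0 < δ ∧ ∃ N : ℕ, ∀ {V : Type} {G : SimpleGraph V}, HoleWithHatFree G →
      ∀ U : Finset V, N ≤ #U → ∃ Q : SimpleGraph V, (Q = G ∨ Q = Gᶜ) ∧ ∃ S ⊆ U, δ * #U ≤ #S ∧
        ∀ v ∈ S, (#(S.filter (Q.Adj v)) : ℝ) ≤ #S / 100 := by
  obtain ⟨δ, hδ, N, h⟩ := exists_few_edges (c := 1 / 800) (by norm_num) (by norm_num) 1600 800 800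
    (by norm_num) (by norm_num) (by norm_num)
  refine ⟨δ, hδ, N, fun {V G} hG U hU => ?_⟩
  obtain ⟨s, S, hSU, hs, hS⟩ := h hG U hU
  have key : ∀ Q : SimpleGraph V, #S = 800 * s →
      (edgeCount Q S S : ℝ) ≤ ((800 : ℕ) + 1 / 800 * (800 : ℕ) ^ 2) * s ^ 2 →
      ∃ T ⊆ U, δ * #U ≤ #T ∧ ∀ v ∈ T, (#(T.filter (Q.Adj v)) : ℝ) ≤ #T / 100 := by
    intro Q hcard he
    have hcardR : (#S : ℝ) = 800 * s := by exact_mod_cast hcard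
    obtain ⟨T, hT, hTn, hdeg⟩ := exists_subset_bounded_degree (G := Q) (S := S) (by
      rw [hcardR]
      push_cast at he
      linarith)
    have hs0 : (0 : ℝ) ≤ s := Nat.cast_nonneg s
    exact ⟨T, hT.trans hSU, by linarith, hdeg⟩
  obtain ⟨hcard, he⟩ | ⟨hcard, he⟩ := hS
  · exact ⟨G, Or.inl rfl, key G hcard he⟩
  · exact ⟨Gᶜ, Or.inr rfl, key Gᶜ hcard he⟩

end Rodl

section Main

open scoped Classical

lemma Linked.forall_adj {G : SimpleGraph V} {D : Finset V} (hD : Linked G D) {x y : V}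
    (h : ∀ x ∈ D, ∀ x' ∈ D, G.Adj x x' → G.Adj x y → G.Adj x' y) (hx : x ∈ D) (hxy : G.Adj x y) :
    ∀ x' ∈ D, G.Adj x' y := by
  by_contra! hne
  obtain ⟨w, hw, hwy⟩ := hne
  obtain ⟨a, ha, b, hb, hab⟩ := hD.2 (D.filter fun v => G.Adj v y) (filter_subset _ _)
    ⟨x, mem_filter.2 ⟨hx, hxy⟩⟩ (fun heq => hwy (filter_eq_self.1 heq w hw))
  rw [mem_filter] at ha
  rw [mem_sdiff, mem_filter] at hb
  exact hb.2 ⟨hb.1, h a ha.1 b hb.1 hab ha.2⟩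

lemma exists_linked_or_le_homMeasure {G : SimpleGraph V} {ε z : ℝ} (hε : ε ≤ 1) (n : ℕ) :
    ∀ X : Finset V, #X ≤ n → (∀ W ⊆ X, (#W : ℝ) ^ ε ≤ homMeasure G W) →
      (∃ D ⊆ X, Linked G D ∧ z ≤ #D) ∨ #X * z ^ (ε - 1) ≤ homMeasure G X := by
  induction n with
  | zero =>
    intro X hX _
    refine Or.inr ?_
    rw [Nat.le_zero.1 hX]
    simp
  | succ n ih =>
    intro X hX hW
    obtain rfl | ⟨x, hx⟩ := X.eq_empty_or_nonempty
    · exact Or.inr (by simp)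
    obtain ⟨D, hDX, hxD, hDl, hDa⟩ := exists_component G hx
    by_cases hz : z ≤ #D
    · exact Or.inl ⟨D, hDX, hDl, hz⟩
    have hDpos : 0 < #D := card_pos.2 ⟨x, hxD⟩
    have hcard : #D + #(X \ D) = #X := by
      rw [add_comm]
      exact card_sdiff_add_card_eq_card hDX
    obtain ⟨D', hD', h'⟩ | h' := ih (X \ D) (by omega) fun W hWX => hW W (hWX.trans sdiff_subset)
    · exact Or.inl ⟨D', hD'.trans sdiff_subset, h'⟩
    refine Or.inr ?_
    have hunion : (homMeasure G D : ℝ) + homMeasure G (X \ D) ≤ homMeasure G X := by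
      have := homMeasure_union disjoint_sdiff hDa
      rw [union_sdiff_of_subset hDX] at this
      exact_mod_cast this
    have hDR : (0 : ℝ) < #D := by exact_mod_cast hDpos
    have hpow : #D * z ^ (ε - 1) ≤ (#D : ℝ) ^ ε := by
      calc #D * z ^ (ε - 1) ≤ #D * (#D : ℝ) ^ (ε - 1) := by
            gcongr ?_ * ?_
            exact Real.rpow_le_rpow_of_nonpos hDR (not_le.1 hz).le (by linarith)
        _ = (#D : ℝ) ^ ε := by
          rw [Real.rpow_sub_one hDR.ne']
          field_simp
    have hcardR : (#D : ℝ) + #(X \ D) = #X := by exact_mod_cast hcard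
    rw [← hcardR, add_mul]
    linarith [hW D hDX]

/-- Splitting a set of size `N` into `a` parts of size `η N / k ^ 3` with `k ≤ a ^ 3` increases the
sum of `ε`-th powers. -/
lemma rpow_le_mul_rpow {ε η N : ℝ} {a k : ℕ} (hε : 0 < ε) (hε' : ε ≤ 1 / 18) (hη : 0 < η)
    (hη' : 1 / 2 ≤ η ^ (2 * ε)) (hN : 0 ≤ N) (ha : 2 ≤ a) (hk : 1 ≤ k) (hka : k ≤ a ^ 3) :
    N ^ ε ≤ a * (η * N / (k : ℝ) ^ 3) ^ ε := by
  have hkR : (1 : ℝ) ≤ k := by exact_mod_cast hk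
  have haR : (2 : ℝ) ≤ a := by exact_mod_cast ha
  have hka' : (k : ℝ) ≤ (a : ℝ) ^ 3 := by exact_mod_cast hka
  rw [Real.div_rpow (by positivity) (by positivity), Real.mul_rpow hη.le hN]
  have h1 : (((k : ℝ) ^ 3) ^ ε) ^ 2 ≤ a := by
    calc (((k : ℝ) ^ 3) ^ ε) ^ 2 ≤ ((((a : ℝ) ^ 3) ^ 3) ^ ε) ^ 2 := by gcongr
      _ = (a : ℝ) ^ (18 * ε) := by
        rw [← pow_mul, ← Real.rpow_natCast (a : ℝ), ← Real.rpow_mul (by linarith),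
          ← Real.rpow_natCast, ← Real.rpow_mul (by linarith)]
        congr 1
        push_cast
        ring
      _ ≤ (a : ℝ) ^ (1 : ℝ) := Real.rpow_le_rpow_of_exponent_le (by linarith) (by linarith)
      _ = a := Real.rpow_one _
  have h2 : 1 / 2 ≤ (η ^ ε) ^ 2 := by
    rw [← Real.rpow_natCast, ← Real.rpow_mul hη.le]
    convert hη' using 2
    push_cast
    ring
  set K := ((k : ℝ) ^ 3) ^ ε
  have hK : 0 < K := by positivity
  have h3 : K ≤ a * η ^ ε := by
    refine le_of_sq_le_sq ?_ (by positivity)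
    rw [mul_pow]
    nlinarith
  have hNε : 0 ≤ N ^ ε := by positivity
  rw [mul_div_assoc', le_div_iff₀ hK]
  nlinarith

lemma rpow_card_le_homMeasure_of_sparse {G : SimpleGraph V} (hG : HoleWithHatFree G)
    {U S : Finset V} {ε η : ℝ} (hε : 0 < ε) (hε' : ε ≤ 1 / 18) (hη : 0 < η)
    (hη' : 1 / 2 ≤ η ^ (2 * ε)) (hSU : S ⊆ U) (hS : 100 ≤ #S) (hSη : 100 * η * #U ≤ #S)
    (hdeg : ∀ v ∈ S, (#(S.filter (G.Adj v)) : ℝ) ≤ #S / 100)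
    (hpair : NoAnticompletePair G S (#S / 20))
    (ih : ∀ W ⊆ U, #W < #U → (#W : ℝ) ^ ε ≤ homMeasure G W) :
    (#U : ℝ) ^ ε ≤ homMeasure G U := by
  obtain ⟨T, X, hT, hX, hdisj, hhom, htri⟩ := exists_teeth hG hS hdeg hpair
  have hkR : (8 : ℝ) ≤ #T := by exact_mod_cast hT
  have hUpos : (0 : ℝ) < #U := by exact_mod_cast (by linarith [card_le_card hSU] : 0 < #U)
  set z : ℝ := η * #U / (#T : ℝ) ^ 3 with hz_def
  have hz : 0 < z := by positivity
  have ihX : ∀ i ∈ T, ∀ W ⊆ X i, (#W : ℝ) ^ ε ≤ homMeasure G W := fun i hi W hW =>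
    ih W (hW.trans ((hX i hi).1.trans hSU)) ((card_le_card hW).trans_lt
      ((hX i hi).2.2.trans_le (card_le_card hSU)))
  by_cases hall : ∀ i ∈ T, ∃ D ⊆ X i, Linked G D ∧ z ≤ #D
  · choose! D hDX hDl hDz using hall
    have hcomplete : ∀ i ∈ T, ∀ j ∈ T, i ≠ j → ∀ x ∈ D i, ∀ y ∈ D j, G.Adj x y →
        ∀ x' ∈ D i, ∀ y' ∈ D j, G.Adj x' y' := by
      intro i hi j hj hij x hx y hy hxy x' hx' y' hy'
      have h1 := (hDl i hi).forall_adj (fun u hu u' hu' =>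
        hhom i hi j hj hij u (hDX i hi hu) u' (hDX i hi hu') y (hDX j hj hy)) hx hxy x' hx'
      exact ((hDl j hj).forall_adj (fun u hu u' hu' =>
        hhom j hj i hi hij.symm u (hDX j hj hu) u' (hDX j hj hu') x' (hDX i hi hx'))
        hy h1.symm y' hy').symm
    let Q : SimpleGraph V := SimpleGraph.fromRel fun i j => ∃ x ∈ D i, ∃ y ∈ D j, G.Adj x y
    have hQ : ∀ i j, Q.Adj i j ↔ i ≠ j ∧ ∃ x ∈ D i, ∃ y ∈ D j, G.Adj x y := by
      intro i j
      rw [SimpleGraph.fromRel_adj]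
      refine and_congr_right fun _ => or_iff_left_of_imp ?_
      rintro ⟨x, hx, y, hy, hxy⟩
      exact ⟨y, hy, x, hx, hxy.symm⟩
    obtain ⟨J, hJT, hJ, hJ2, hJ3⟩ := exists_stable_of_triangleFree (Q := Q) hT (by
      intro i hi j hj k hk hij hjk hik
      obtain ⟨hij, x, hx, y, hy, hxy⟩ := (hQ i j).1 hij
      obtain ⟨hjk, y', hy', w, hw, hyw⟩ := (hQ j k).1 hjk
      obtain ⟨hik, x', hx', w', hw', hxw⟩ := (hQ i k).1 hik
      exact htri i hi j hj k hk hij hjk hik x (hDX i hi hx) y (hDX j hj hy) w (hDX k hk hw) hxy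
        (hcomplete j hj k hk hjk y' hy' w hw hyw y hy w hw)
        (hcomplete i hi k hk hik x' hx' w' hw' hxw x hx w hw))
    have hsum : ∑ i ∈ J, homMeasure G (D i) ≤ homMeasure G (J.biUnion D) :=
      sum_homMeasure_le J
        (fun i hi j hj hij => disjoint_of_subset_left (hDX i (hJT hi))
          (disjoint_of_subset_right (hDX j (hJT hj)) (hdisj i (hJT hi) j (hJT hj) hij)))
        (fun i hi j hj hij x hx y hy hxy =>
          hJ i hi j hj ((hQ i j).2 ⟨hij, x, hx, y, hy, hxy⟩))
    have hmono : homMeasure G (J.biUnion D) ≤ homMeasure G U :=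
      homMeasure_mono G (biUnion_subset.2 fun i hi =>
        (hDX i (hJT hi)).trans ((hX i (hJT hi)).1.trans hSU))
    calc (#U : ℝ) ^ ε ≤ #J * z ^ ε :=
          rpow_le_mul_rpow hε hε' hη hη' hUpos.le hJ2 (by omega) hJ3
      _ = ∑ i ∈ J, z ^ ε := by simp
      _ ≤ ∑ i ∈ J, (homMeasure G (D i) : ℝ) := sum_le_sum fun i hi =>
        (Real.rpow_le_rpow hz.le (hDz i (hJT hi)) hε.le).trans
          (ihX i (hJT hi) _ (hDX i (hJT hi)))
      _ ≤ homMeasure G U := by exact_mod_cast hsum.trans hmono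
  · push Not at hall
    obtain ⟨i, hi, hno⟩ := hall
    obtain ⟨D, hD, hDl, hDz⟩ | hle :=
      exists_linked_or_le_homMeasure (G := G) (z := z) (by linarith : ε ≤ 1) _ (X i) le_rfl
        (ihX i hi)
    · exact absurd hDz (not_le.2 (hno D hD hDl))
    have hXz : #T * z ≤ #(X i) := by
      have h1 : η * #U ≤ #(X i) * (#T : ℝ) ^ 2 := by linarith [(hX i hi).2.1]
      rw [hz_def, mul_div_assoc', div_le_iff₀ (by positivity)]
      nlinarith
    calc (#U : ℝ) ^ ε ≤ #T * z ^ ε :=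
          rpow_le_mul_rpow hε hε' hη hη' hUpos.le (by omega) (by omega)
            (Nat.le_self_pow (by norm_num) _)
      _ = #T * z * z ^ (ε - 1) := by
        rw [Real.rpow_sub_one hz.ne']
        field_simp
      _ ≤ #(X i) * z ^ (ε - 1) := by gcongr
      _ ≤ homMeasure G (X i) := hle
      _ ≤ homMeasure G U := by exact_mod_cast homMeasure_mono G ((hX i hi).1.trans hSU)

lemma exists_exponent {C : ℝ} (hC : 2 ≤ C) : ∃ ε : ℝ, 0 < ε ∧ ε ≤ 1 / 18 ∧ C ^ (2 * ε) ≤ 2 := by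
  have hlog : 0 < Real.log C := Real.log_pos (by linarith)
  have hlog2 : 0 < Real.log 2 := Real.log_pos (by norm_num)
  refine ⟨min (1 / 18) (Real.log 2 / (2 * Real.log C)), by positivity, min_le_left _ _, ?_⟩
  rw [Real.rpow_le_iff_le_log (by linarith) (by norm_num)]
  have := min_le_right (1 / 18) (Real.log 2 / (2 * Real.log C))
  rw [le_div_iff₀ (by positivity)] at this
  linarith

/-- A linear anticomplete pair would make the product of clique and stability numbers large. -/
lemma noAnticompletePair_of_homMeasure_lt {G : SimpleGraph V} {U S : Finset V} {ε η : ℝ}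
    (hε : 0 < ε) (hη : 0 < η) (hη' : 1 / 2 ≤ η ^ (2 * ε)) (hSU : S ⊆ U) (hS : 100 ≤ #S)
    (hSη : 100 * η * #U ≤ #S) (ih : ∀ W ⊆ U, #W < #U → (#W : ℝ) ^ ε ≤ homMeasure G W)
    (hU : (homMeasure G U : ℝ) < (#U : ℝ) ^ ε) : NoAnticompletePair G S (#S / 20) := by
  intro A hA B hB hd hAB hAm
  by_contra! hBm
  have hSR : (100 : ℝ) ≤ #S := by exact_mod_cast hS
  have hcard : #A + #B ≤ #U := by
    rw [← card_union_of_disjoint hd]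
    exact card_le_card (union_subset (hA.trans hSU) (hB.trans hSU))
  have hA0 : 0 < #A := by exact_mod_cast (by linarith : (0 : ℝ) < #A)
  have hB0 : 0 < #B := by exact_mod_cast (by linarith : (0 : ℝ) < #B)
  have hunion : (homMeasure G A : ℝ) + homMeasure G B ≤ homMeasure G U := by
    exact_mod_cast (homMeasure_union hd hAB).trans
      (homMeasure_mono G (union_subset (hA.trans hSU) (hB.trans hSU)))
  have hηU : 0 ≤ η * #U := by positivity
  have key : ∀ W : Finset V, W ⊆ U → #W < #U → (#S : ℝ) / 20 ≤ #W →
      η ^ ε * (#U : ℝ) ^ ε ≤ homMeasure G W := by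
    intro W hW hWU hWS
    rw [← Real.mul_rpow hη.le (Nat.cast_nonneg _)]
    exact (Real.rpow_le_rpow hηU (by linarith) hε.le).trans (ih W hW hWU)
  have hAle := key A (hA.trans hSU) (by omega) hAm
  have hBle := key B (hB.trans hSU) (by omega) hBm
  have h2 : 1 / 2 ≤ η ^ ε := by
    have h3 : (η ^ ε) ^ 2 = η ^ (2 * ε) := by
      rw [← Real.rpow_natCast, ← Real.rpow_mul hη.le]
      congr 1
      push_cast
      ring
    have h4 : 0 < η ^ ε := by positivity
    nlinarith
  have hUε : 0 ≤ (#U : ℝ) ^ ε := by positivity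
  nlinarith

lemma exists_rpow_card_le_homMeasure :
    ∃ ε : ℝ, 0 < ε ∧ ∀ {V : Type} {G : SimpleGraph V}, HoleWithHatFree G →
      ∀ U : Finset V, (#U : ℝ) ^ ε ≤ homMeasure G U := by
  obtain ⟨δ, hδ, N, hsparse⟩ := exists_sparse_subset
  obtain ⟨ε, hε, hε', hC⟩ :=
    exists_exponent (C := max (max 2 (N : ℝ)) (100 / δ)) (by simp)
  set C := max (max 2 (N : ℝ)) (100 / δ)
  have hC2 : 2 ≤ C := (le_max_left _ _).trans (le_max_left _ _)
  have hCN : (N : ℝ) ≤ C := (le_max_right _ _).trans (le_max_left _ _)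
  have hCδ : 100 / δ ≤ C := le_max_right _ _
  have hη : 0 < δ / 100 := by positivity
  have hη' : 1 / 2 ≤ (δ / 100) ^ (2 * ε) := by
    have h1 : (100 / δ) ^ (2 * ε) ≤ 2 :=
      (Real.rpow_le_rpow (by positivity) hCδ (by positivity)).trans hC
    rw [← inv_div 100 δ, Real.inv_rpow (by positivity), one_div]
    exact inv_anti₀ (by positivity) h1
  refine ⟨ε, hε, fun {V G} hG U => ?_⟩
  induction hn : #U using Nat.strong_induction_on generalizing U with
  | _ n ih =>
    subst hn
    by_contra! hlt
    have ih' : ∀ W ⊆ U, #W < #U → (#W : ℝ) ^ ε ≤ homMeasure G W := fun W _ hW => ih _ hW W rfl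
    have hU2 : 2 ≤ #U := by
      by_contra! h
      obtain h0 | h1 : #U = 0 ∨ #U = 1 := by omega
      · rw [h0, Nat.cast_zero, Real.zero_rpow hε.ne'] at hlt
        exact absurd hlt (not_lt.2 (Nat.cast_nonneg _))
      · have hne : U.Nonempty := card_pos.1 (by omega)
        have h2 : 1 ≤ homMeasure G U :=
          Nat.mul_pos (one_le_maxClique G hne) (one_le_maxClique Gᶜ hne)
        have h3 : (1 : ℝ) ≤ homMeasure G U := by exact_mod_cast h2
        rw [h1, Nat.cast_one, Real.one_rpow] at hlt
        linarith
    have hUC : C ≤ #U := by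
      by_contra! h
      have h1 : (2 : ℝ) ≤ homMeasure G U := by exact_mod_cast two_le_homMeasure G hU2
      have h2 : (#U : ℝ) ^ ε ≤ C ^ (2 * ε) :=
        (Real.rpow_le_rpow (Nat.cast_nonneg _) h.le hε.le).trans
          (Real.rpow_le_rpow_of_exponent_le (by linarith) (by linarith))
      linarith
    obtain ⟨Q, hQ, S, hSU, hSδ, hdeg⟩ := hsparse hG U (by exact_mod_cast hCN.trans hUC)
    have hS : 100 ≤ #S := by
      have h1 : 100 / δ ≤ #U := hCδ.trans hUC
      rw [div_le_iff₀ hδ] at h1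
      exact_mod_cast (by linarith : (100 : ℝ) ≤ #S)
    have hSη : 100 * (δ / 100) * #U ≤ #S := by linarith
    have hQhom : ∀ W : Finset V, homMeasure Q W = homMeasure G W := by
      obtain rfl | rfl := hQ
      · exact fun _ => rfl
      · exact homMeasure_compl G
    have hpair : NoAnticompletePair Q S (#S / 20) :=
      noAnticompletePair_of_homMeasure_lt hε hη hη' hSU hS hSη
        (fun W hW hWU => by rw [hQhom]; exact ih' W hW hWU) (by rwa [hQhom])
    obtain rfl | rfl := hQ
    · exact absurd (rpow_card_le_homMeasure_of_sparse hG hε hε' hη hη' hSU hS hSη hdeg hpair ih')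
        (not_le.2 hlt)
    · obtain ⟨p, hp⟩ := exists_induced_path_five hS hdeg hpair
      have hadj : ∀ i j, i < j → (G.Adj (p i) (p j) ↔ ¬ j.val = i.val + 1) := by
        intro i j hij
        have := hp i j hij
        rw [← this.2, SimpleGraph.compl_adj]
        simp [this.1]
      refine hG.false_of_house p (fun i j hij => ?_) fun i j hij => ?_
      · obtain h | h := hij.lt_or_gt
        · exact (hp i j h).1
        · exact (hp j i h).1.symm
      · obtain h | h := hij.lt_or_gt
        · rw [hadj i j h]
          have := Fin.lt_def.1 h
          omega
        · rw [G.adj_comm, hadj j i h]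
          have := Fin.lt_def.1 h
          omega

end Main

theorem statement_0 :
    ∃ ε : ℝ, 0 < ε ∧ ∀ (V : Type) [Fintype V] (G : SimpleGraph V),
      HoleWithHatFree G →
      ∃ S : Finset V, (G.IsClique (S : Set V) ∨ Gᶜ.IsClique (S : Set V)) ∧
        (Fintype.card V : ℝ) ^ ε ≤ (S.card : ℝ) := by
  obtain ⟨ε, hε, h⟩ := exists_rpow_card_le_homMeasure
  refine ⟨ε / 2, by positivity, fun V _ G hG => ?_⟩
  have hle := h hG univ
  rw [card_univ, homMeasure, Nat.cast_mul] at hle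
  have hsq : ((Fintype.card V : ℝ) ^ (ε / 2)) ^ 2 = (Fintype.card V : ℝ) ^ ε := by
    rw [← Real.rpow_natCast, ← Real.rpow_mul (Nat.cast_nonneg _)]
    congr 1
    push_cast
    ring
  have hnonneg : 0 ≤ (Fintype.card V : ℝ) ^ (ε / 2) := by positivity
  obtain ⟨A, -, hA, hAcard⟩ := exists_maxClique G univ
  obtain ⟨B, -, hB, hBcard⟩ := exists_maxClique Gᶜ univ
  rw [← hAcard, ← hBcard, ← hsq] at hle
  by_cases hcase : (Fintype.card V : ℝ) ^ (ε / 2) ≤ #A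
  · exact ⟨A, Or.inl hA, hcase⟩
  · refine ⟨B, Or.inr hB, ?_⟩
    by_contra! hlt
    push Not at hcase
    have hA0 : (0 : ℝ) ≤ #A := Nat.cast_nonneg _
    nlinarith

end EHhat
end

section
/- Let α ≥ 1 and let G be a finite simple graph that is α-narrow. Then G has a clique or a stable set of cardinality at least |V(G)|^ε, where ε = 1/(2α). -/
open Finset

namespace EHhat

variable {V : Type*}

/-- If the chromatic number of an induced subgraph equals its clique number, and every clique and
every stable set of `G` has at most `M` vertices, then the subgraph has at most `M * M` vertices. -/
lemma card_le_mul_of_chromaticNumber_eq_cliqueNum {W : Type*} [Fintype W] {G : SimpleGraph V}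
    {H : SimpleGraph W} (e : H ↪g G) (hH : H.chromaticNumber = (H.cliqueNum : ℕ∞)) {M : ℕ}
    (hM : ∀ S : Finset V, G.IsClique (S : Set V) ∨ Gᶜ.IsClique (S : Set V) → S.card ≤ M) :
    Fintype.card W ≤ M * M := by
  classical
  obtain ⟨c⟩ := SimpleGraph.chromaticNumber_le_iff_colorable.mp hH.le
  obtain ⟨K, hK⟩ := H.exists_isNClique_cliqueNum
  have hω : H.cliqueNum ≤ M := by
    rw [← hK.card_eq, ← Finset.card_map e.toEmbedding]
    refine hM _ (Or.inl ?_)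
    rintro x hx y hy hxy
    simp only [Finset.coe_map, Set.mem_image] at hx hy
    obtain ⟨a, ha, rfl⟩ := hx
    obtain ⟨b, hb, rfl⟩ := hy
    exact e.map_adj_iff.mpr (hK.isClique ha hb (by rintro rfl; exact hxy rfl))
  have hclass : ∀ i ∈ (Finset.univ : Finset (Fin H.cliqueNum)),
      (Finset.univ.filter fun w => c w = i).card ≤ M := by
    intro i _
    rw [← Finset.card_map e.toEmbedding]
    refine hM _ (Or.inr ?_)
    rintro x hx y hy hxy
    simp only [Finset.coe_map, Set.mem_image, Finset.coe_filter, Finset.mem_univ, true_and,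
      Set.mem_ofPred_eq] at hx hy
    obtain ⟨a, ha, rfl⟩ := hx
    obtain ⟨b, hb, rfl⟩ := hy
    exact ⟨hxy, fun h => c.valid (e.map_adj_iff.mp h) (ha.trans hb.symm)⟩
  calc Fintype.card W
      ≤ M * (Finset.univ : Finset (Fin H.cliqueNum)).card :=
        Finset.card_le_mul_card_image_of_maps_to (fun w _ => Finset.mem_univ (c w)) M hclass
    _ ≤ M * M := by simpa using Nat.mul_le_mul_left M hω

theorem statement_1 {V : Type} [Fintype V] (G : SimpleGraph V) (α : ℝ) (hα : 1 ≤ α)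
    (hnarrow : Narrow G α) :
    ∃ S : Finset V, (G.IsClique (S : Set V) ∨ Gᶜ.IsClique (S : Set V)) ∧
      (Fintype.card V : ℝ) ^ (1 / (2 * α)) ≤ (S.card : ℝ) := by
  classical
  obtain ⟨S, hS, hmax⟩ := Finset.exists_max_image
    (Finset.univ.filter fun S : Finset V => G.IsClique (S : Set V) ∨ Gᶜ.IsClique (S : Set V))
    Finset.card ⟨∅, by simp⟩
  simp only [Finset.mem_filter, Finset.mem_univ, true_and] at hS hmax
  refine ⟨S, hS, ?_⟩
  have hα0 : 0 < 2 * α := by linarith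
  rcases isEmpty_or_nonempty V with hV | ⟨⟨v⟩⟩
  · rw [Fintype.card_eq_zero, Nat.cast_zero, Real.zero_rpow (by positivity)]
    positivity
  have hpos : 0 < S.card := by
    have := hmax {v} (by simp)
    simpa using this
  have hM : (0 : ℝ) < S.card := by exact_mod_cast hpos
  have hgood : GoodOn G fun _ => ((S.card : ℝ) ^ (2 : ℝ))⁻¹ := by
    refine ⟨fun _ => by positivity, fun T hT => ?_⟩
    have hcard := card_le_mul_of_chromaticNumber_eq_cliqueNum
      ((SimpleGraph.Embedding.induce (G := G) (T : Set V)).comp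
        (SimpleGraph.Embedding.induce ((Finset.univ : Finset (T : Set V)) : Set (T : Set V))))
      (hT Finset.univ) hmax
    have hTS : (T.card : ℝ) ≤ (S.card : ℝ) ^ (2 : ℝ) := by
      rw [Real.rpow_two, sq]
      have : T.card ≤ S.card * S.card := by simpa using hcard
      exact_mod_cast this
    rw [Finset.sum_const, nsmul_eq_mul, ← div_eq_mul_inv]
    exact div_le_one_of_le₀ hTS (by positivity)
  have hsum := hnarrow _ hgood
  rw [Finset.sum_const, nsmul_eq_mul, Real.inv_rpow (by positivity), ← Real.rpow_mul hM.le,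
    ← div_eq_mul_inv, div_le_one (by positivity), Finset.card_univ] at hsum
  calc (Fintype.card V : ℝ) ^ (1 / (2 * α))
      ≤ ((S.card : ℝ) ^ (2 * α)) ^ (1 / (2 * α)) := by gcongr
    _ = S.card := by
      rw [← Real.rpow_mul hM.le, mul_one_div_cancel hα0.ne', Real.rpow_one]

end EHhat
end
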